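/- Let L be a lens partition of ℝ⁸. Then its defect equals Δ_L = 4 · (4π³((16/9)π − (93/35)√3))^{1/8} ≈ 7.29. -/

import Mathlib

open MeasureTheory Metric Set Filter Topology
open scoped ENNReal symmDiff RealInnerProductSpace

noncomputable section

/-- `d`-dimensional Euclidean space. -/
abbrev Euc (d : ℕ) : Type := EuclideanSpace ℝ (Fin d)

/-- The divergence of a vector field `φ : ℝ^d → ℝ^d`. -/
def vdiv {d : ℕ} (φ : Euc d → Euc d) (x : Euc d) : ℝ :=
  ∑ i, fderiv ℝ φ x (EuclideanSpace.single i 1) i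

/-- The perimeter `Per(E, B) = |D 1_E|(B)` of `E` relative to `B`, defined as the
outer-regularized total variation (on `B`) of the distributional derivative of the
characteristic function of `E`. -/
def perim {d : ℕ} (E B : Set (Euc d)) : ℝ≥0∞ :=
  ⨅ (U : Set (Euc d)) (_ : IsOpen U) (_ : B ⊆ U),
    ⨆ (φ : Euc d → Euc d) (_ : ContDiff ℝ 1 φ) (_ : HasCompactSupport φ)
      (_ : tsupport φ ⊆ U) (_ : ∀ x, ‖φ x‖ ≤ 1),
      ENNReal.ofReal (∫ x in E, vdiv φ x)

/-- A Caccioppoli set: a measurable set with locally finite perimeter. -/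
def Caccioppoli {d : ℕ} (E : Set (Euc d)) : Prop :=
  MeasurableSet E ∧ ∀ r : ℝ, 0 < r → perim E (ball 0 r) < ⊤

/-- An `N`-partition of `ℝ^d`: measurable regions, pairwise Lebesgue-disjoint,
whose union has full measure. -/
structure IsPartition {d N : ℕ} (E : Fin N → Set (Euc d)) : Prop where
  meas : ∀ j, MeasurableSet (E j)
  disj : ∀ i j, i ≠ j → volume (E i ∩ E j) = 0
  full : volume ((univ : Set (Euc d)) \ ⋃ j, E j) = 0

/-- Perimeter of a partition in `B`: half the sum of the perimeters of the regions. -/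
def partPerim {d N : ℕ} (E : Fin N → Set (Euc d)) (B : Set (Euc d)) : ℝ≥0∞ :=
  (∑ k, perim (E k) B) / 2

/-- `E` is `J`-isoperimetric in the (closed) set `X`. -/
def IsJIsoperimetric {d N : ℕ} (E : Fin N → Set (Euc d)) (X : Set (Euc d))
    (J : Set (Fin N)) : Prop :=
  ∀ K : Set (Euc d), IsCompact K → K ⊆ X →
    ∀ F : Fin N → Set (Euc d), IsPartition F →
      (∀ j, (F j) ∆ (E j) ⊆ K) →
      (∀ j ∈ J, volume (F j ∩ K) = volume (E j ∩ K)) →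
      partPerim E K ≤ partPerim F K

/-- `E` is isoperimetric: `J`-isoperimetric in `ℝ^d` with `J` the finite-volume regions. -/
def IsIsoperimetric {d N : ℕ} (E : Fin N → Set (Euc d)) : Prop :=
  IsJIsoperimetric E univ {j | volume (E j) ≠ ⊤}

/-- `L¹_loc` convergence of a family of sets along a filter. -/
def SetTendstoL1loc {d : ℕ} {ι : Type*} (l : Filter ι) (A : ι → Set (Euc d))
    (A' : Set (Euc d)) : Prop :=
  ∀ B : Set (Euc d), MeasurableSet B → Bornology.IsBounded B →
    Tendsto (fun n => volume ((A n ∆ A') ∩ B)) l (𝓝 0)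

/-- `L¹_loc` convergence of partitions. -/
def PartTendstoL1loc {d N : ℕ} {ι : Type*} (l : Filter ι) (E : ι → Fin N → Set (Euc d))
    (F : Fin N → Set (Euc d)) : Prop :=
  ∀ j, SetTendstoL1loc l (fun n => E n j) (F j)

/-- The translate `E - x`. -/
def tr {d : ℕ} (E : Set (Euc d)) (x : Euc d) : Set (Euc d) := (fun y => y + x) ⁻¹' E

/-- The dilation `E / r`. -/
def dil {d : ℕ} (E : Set (Euc d)) (r : ℝ) : Set (Euc d) := (fun y => r • y) ⁻¹' E

/-- A (positively homogeneous) cone with vertex at the origin. -/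
def IsCone {d : ℕ} (C : Set (Euc d)) : Prop := ∀ t : ℝ, 0 < t → ∀ x ∈ C, t • x ∈ C

/-- The measure-theoretic representative of a set: its points of essential closure. -/
def essCl {d : ℕ} (E : Set (Euc d)) : Set (Euc d) :=
  {x | ∀ r > 0, 0 < volume (E ∩ ball x r)}

/-- Integration by parts of a Lipschitz function against a compactly supported field. -/
theorem integral_mul_vdiv {d : ℕ} {f : Euc d → ℝ} {F : Euc d → Euc d} {C : NNReal}
    (hf : LipschitzWith C f) (hF : ∀ᵐ x, HasGradientAt f (F x) x)
    {φ : Euc d → Euc d} (hφ : ContDiff ℝ 1 φ) (hφc : HasCompactSupport φ) :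
    ∫ x, f x * vdiv φ x = - ∫ x, ⟪F x, φ x⟫ := by
  have hcoord : ∀ i, ContDiff ℝ 1 (fun x => φ x i) := fun i => by fun_prop
  have hcomp : ∀ i, HasCompactSupport (fun x => φ x i) := fun i =>
    hφc.comp_left (g := fun y : Euc d => y i) (by simp)
  have hcont : ∀ i, Continuous fun x => fderiv ℝ φ x (EuclideanSpace.single i 1) i := fun i => by
    have := (hφ.continuous_fderiv one_ne_zero).clm_apply
      (continuous_const (y := (EuclideanSpace.single i (1 : ℝ) : Euc d)))
    fun_prop
  have hfd : ∀ i x, lineDeriv ℝ (fun x => φ x i) x (-EuclideanSpace.single i 1)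
      = - fderiv ℝ φ x (EuclideanSpace.single i 1) i := by
    intro i x
    have h1 : HasFDerivAt (fun x => φ x i)
        ((EuclideanSpace.proj i : Euc d →L[ℝ] ℝ).comp (fderiv ℝ φ x)) x :=
      (EuclideanSpace.proj i : Euc d →L[ℝ] ℝ).hasFDerivAt.comp x
        (hφ.differentiable (by norm_num) x).hasFDerivAt
    rw [(h1.hasLineDerivAt _).lineDeriv]
    simp
  have hsupp : ∀ i, HasCompactSupport fun x => fderiv ℝ φ x (EuclideanSpace.single i 1) i :=
    fun i => (hφc.fderiv (𝕜 := ℝ)).comp_left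
      (g := fun T : Euc d →L[ℝ] Euc d => T (EuclideanSpace.single i 1) i) (by simp)
  have hint1 : ∀ i ∈ Finset.univ, Integrable
      fun x => f x * fderiv ℝ φ x (EuclideanSpace.single i 1) i := fun i _ =>
    (hf.continuous.mul (hcont i)).integrable_of_hasCompactSupport (hsupp i).mul_left
  have hint2 : ∀ i ∈ Finset.univ, Integrable
      fun x => lineDeriv ℝ f x (EuclideanSpace.single i 1) * φ x i := fun i _ => by
    have := ((hcoord i).continuous.integrable_of_hasCompactSupport (hcomp i)
      (μ := (volume : Measure (Euc d)))).smul_of_top_left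
        (hf.memLp_lineDeriv (μ := volume) (EuclideanSpace.single i 1))
    simpa only [Pi.smul_apply', smul_eq_mul, mul_comm, Pi.mul_def] using this
  have key : ∀ i, ∫ x, f x * fderiv ℝ φ x (EuclideanSpace.single i 1) i
      = - ∫ x, lineDeriv ℝ f x (EuclideanSpace.single i 1) * φ x i := by
    intro i
    obtain ⟨D, hD⟩ := (hcoord i).lipschitzWith_of_hasCompactSupport (hcomp i) (by norm_num)
    rw [hf.integral_lineDeriv_mul_eq hD (hcomp i), ← integral_neg]
    refine integral_congr_ae (.of_forall fun x => ?_)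
    simp only [hfd]
    ring
  have : ∫ x, ⟪F x, φ x⟫ = ∫ x, ∑ i, lineDeriv ℝ f x (EuclideanSpace.single i 1) * φ x i := by
    refine integral_congr_ae ?_
    filter_upwards [hF] with x hx
    rw [PiLp.inner_apply]
    refine Finset.sum_congr rfl fun i _ => ?_
    rw [(hx.hasFDerivAt.hasLineDerivAt _).lineDeriv]
    simp [EuclideanSpace.inner_single_right, mul_comm]
  rw [this, integral_finsetSum _ hint2]
  simp only [vdiv, Finset.mul_sum]
  rw [integral_finsetSum _ hint1, ← Finset.sum_neg_distrib]
  exact Finset.sum_congr rfl fun i _ => key i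

/-- The divergence of a compactly supported field has zero integral. -/
theorem integral_vdiv_eq_zero {d : ℕ} {φ : Euc d → Euc d} (hφ : ContDiff ℝ 1 φ)
    (hφc : HasCompactSupport φ) : ∫ x, vdiv φ x = 0 := by
  have h := integral_mul_vdiv (f := fun _ : Euc d => (1 : ℝ)) (F := fun _ => 0)
    (LipschitzWith.const 1) (.of_forall fun x => hasGradientAt_const x (1 : ℝ)) hφ hφc
  simpa using h

theorem continuous_vdiv {d : ℕ} {φ : Euc d → Euc d} (hφ : ContDiff ℝ 1 φ) :
    Continuous (vdiv φ) := by
  refine continuous_finsetSum _ fun i _ => ?_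
  have := (hφ.continuous_fderiv one_ne_zero).clm_apply
    (continuous_const (y := (EuclideanSpace.single i (1 : ℝ) : Euc d)))
  fun_prop

theorem integrable_vdiv {d : ℕ} {φ : Euc d → Euc d} (hφ : ContDiff ℝ 1 φ)
    (hφc : HasCompactSupport φ) : Integrable (vdiv φ) := by
  refine (continuous_vdiv hφ).integrable_of_hasCompactSupport ?_
  exact (hφc.fderiv (𝕜 := ℝ)).comp_left
    (g := fun T : Euc d →L[ℝ] Euc d => ∑ i, T (EuclideanSpace.single i 1) i) (by simp)

section GaussGreen

variable {d : ℕ} {g : Euc d → ℝ}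

theorem volume_level_eq_zero (hconv : ConvexOn ℝ univ g)
    (hhom : ∀ t : ℝ, 0 < t → ∀ x, g (t • x) = t * g x) {t : ℝ} (ht : 0 < t) :
    volume {x | g x = t} = 0 := by
  have h1 : Convex ℝ {x | g x < t} := by simpa using hconv.convex_lt t
  refine measure_mono_null (fun x (hx : g x = t) => ?_) (h1.addHaar_frontier volume)
  refine ⟨?_, fun h => ?_⟩
  · have h2 : Tendsto (fun s : ℝ => s • x) (𝓝[<] 1) (𝓝 x) := by
      have : Continuous fun s : ℝ => s • x := by fun_prop
      simpa using (this.tendsto 1).mono_left nhdsWithin_le_nhds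
    refine mem_closure_of_tendsto h2 ?_
    filter_upwards [Ioo_mem_nhdsLT (zero_lt_one (α := ℝ))] with s hs
    simp only [hhom s hs.1, hx]
    nlinarith [hs.2]
  · exact absurd (interior_subset h) (by simp [hx])

open scoped Pointwise in
theorem smul_sublevel (hhom : ∀ t : ℝ, 0 < t → ∀ x, g (t • x) = t * g x) {s : ℝ} (hs : 0 < s) :
    s • {x | g x < 1} = {x | g x < s} := by
  ext x
  rw [mem_smul_set_iff_inv_smul_mem₀ hs.ne']
  simp only [mem_ofPred_eq, hhom _ (inv_pos.2 hs)]
  rw [inv_mul_lt_iff₀ hs, mul_one]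

theorem isBounded_sublevel {c : ℝ} (hc : 0 < c) (hgc : ∀ x, c * ‖x‖ ≤ g x) (t : ℝ) :
    Bornology.IsBounded {x | g x < t} := by
  refine isBounded_iff_forall_norm_le.2 ⟨t / c, fun x (hx : g x < t) => ?_⟩
  rw [le_div_iff₀ hc]
  linarith [hgc x]

open scoped Pointwise in
/-- A function that is homogeneous of degree zero scales like the volume on sublevel sets. -/
theorem setIntegral_sublevel (hhom : ∀ t : ℝ, 0 < t → ∀ x, g (t • x) = t * g x)
    {G : Euc d → ℝ} (hG : ∀ t : ℝ, 0 < t → ∀ x, G (t • x) = G x) {s : ℝ} (hs : 0 < s) :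
    ∫ x in {x | g x < s}, G x = s ^ d * ∫ x in {x | g x < 1}, G x := by
  have h := Measure.setIntegral_comp_smul_of_pos volume G {x | g x < 1} hs
  rw [smul_sublevel hhom hs] at h
  simp only [hG s hs, finrank_euclideanSpace, Fintype.card_fin, smul_eq_mul] at h
  rw [h]
  field_simp

theorem hasGradientAt_cutoff {ν x : Euc d} {ε : ℝ} (hε : 0 < ε) (hg : HasGradientAt g ν x)
    (h1 : g x ≠ 1) (h2 : g x ≠ 1 - ε) :
    HasGradientAt (fun x => max 0 (min 1 ((1 - g x) / ε)))
      (if 1 - ε ≤ g x ∧ g x < 1 then (-ε⁻¹) • ν else 0) x := by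
  have hcont := hg.differentiableAt.continuousAt
  rcases lt_or_gt_of_ne h1 with h1 | h1
  · rcases lt_or_gt_of_ne h2 with h2 | h2
    · rw [if_neg (fun h => absurd h.1 (not_le.2 h2))]
      refine (hasGradientAt_const x (1 : ℝ)).congr_of_eventuallyEq ?_
      filter_upwards [hcont.eventually_lt_const h2] with y hy
      have : 1 ≤ (1 - g y) / ε := by rw [le_div_iff₀ hε]; linarith
      simp [this]
    · rw [if_pos ⟨h2.le, h1⟩]
      have h3 : HasGradientAt (fun x => (1 - g x) / ε) ((-ε⁻¹) • ν) x := by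
        rw [hasGradientAt_iff_hasFDerivAt] at hg ⊢
        have := (hg.const_sub 1).mul_const ε⁻¹
        convert! this using 1
        simp
      refine h3.congr_of_eventuallyEq ?_
      filter_upwards [hcont.eventually_lt_const h1, hcont.eventually_const_lt h2] with y hy hy'
      have h4 : (1 - g y) / ε ≤ 1 := by rw [div_le_iff₀ hε]; linarith
      have h5 : 0 ≤ (1 - g y) / ε := div_nonneg (by linarith) hε.le
      simp [h4, h5]
  · rw [if_neg (fun h => absurd h.2 (not_lt.2 h1.le))]
    refine (hasGradientAt_const x (0 : ℝ)).congr_of_eventuallyEq ?_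
    filter_upwards [hcont.eventually_const_lt h1] with y hy
    have : (1 - g y) / ε ≤ 0 := div_nonpos_of_nonpos_of_nonneg (by linarith) hε.le
    simp [this]

variable {ν : Euc d → Euc d} {C : NNReal}

theorem integral_cutoff_mul_vdiv (hg : LipschitzWith C g) (hconv : ConvexOn ℝ univ g)
    (hhom : ∀ t : ℝ, 0 < t → ∀ x, g (t • x) = t * g x)
    (hν : ∀ᵐ x, HasGradientAt g (ν x) x)
    {φ : Euc d → Euc d} (hφ : ContDiff ℝ 1 φ) (hφc : HasCompactSupport φ)
    {ε : ℝ} (hε : 0 < ε) (hε1 : ε < 1) :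
    ∫ x, max 0 (min 1 ((1 - g x) / ε)) * vdiv φ x
      = ε⁻¹ * ∫ x in {x | 1 - ε ≤ g x ∧ g x < 1}, ⟪ν x, φ x⟫ := by
  have hlip : ∃ K : NNReal, LipschitzWith K fun x => max 0 (min 1 ((1 - g x) / ε)) := by
    have h1 : LipschitzWith (Real.toNNReal ε⁻¹ * C) fun x => (1 - g x) / ε := by
      refine LipschitzWith.of_dist_le_mul fun x y => ?_
      have := hg.dist_le_mul x y
      rw [Real.dist_eq] at this ⊢
      rw [← sub_div, abs_div, abs_of_pos hε, div_eq_inv_mul, NNReal.coe_mul,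
        Real.coe_toNNReal _ (inv_pos.2 hε).le, mul_assoc]
      have h2 : |1 - g x - (1 - g y)| = |g x - g y| := by
        rw [← abs_neg]; congr 1; ring
      rw [h2]
      gcongr
    exact ⟨_, (h1.const_min 1).const_max 0⟩
  obtain ⟨K, hK⟩ := hlip
  rw [integral_mul_vdiv hK (F := fun x => if 1 - ε ≤ g x ∧ g x < 1 then (-ε⁻¹) • ν x else 0)
    ?_ hφ hφc]
  · have hm : MeasurableSet {x | 1 - ε ≤ g x ∧ g x < 1} :=
      (measurableSet_le measurable_const hg.continuous.measurable).inter
        (measurableSet_lt hg.continuous.measurable measurable_const)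
    rw [← integral_const_mul, ← integral_indicator hm, ← integral_neg]
    congr 1
    ext x
    by_cases hx : 1 - ε ≤ g x ∧ g x < 1
    · rw [indicator_of_mem (by exact hx), if_pos hx]
      simp [inner_smul_left]
    · rw [indicator_of_notMem (by exact hx), if_neg hx]
      simp
  · have n1 := volume_level_eq_zero hconv hhom zero_lt_one
    have n2 := volume_level_eq_zero hconv hhom (sub_pos.2 hε1)
    filter_upwards [hν, measure_eq_zero_iff_ae_notMem.1 n1, measure_eq_zero_iff_ae_notMem.1 n2]
      with x hx h1 h2
    exact hasGradientAt_cutoff hε hx h1 h2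

/-- **Gauss-Green formula** for the unit sublevel set of a positively homogeneous convex gauge,
with the boundary integral written as a volume integral by radial projection. -/
theorem gauss_green (hg : LipschitzWith C g) (hconv : ConvexOn ℝ univ g)
    (hhom : ∀ t : ℝ, 0 < t → ∀ x, g (t • x) = t * g x)
    {c : ℝ} (hc : 0 < c) (hgc : ∀ x, c * ‖x‖ ≤ g x)
    (hνm : Measurable ν) {B : ℝ} (hνB : ∀ x, ‖ν x‖ ≤ B)
    (hνhom : ∀ t : ℝ, 0 < t → ∀ x, ν (t • x) = ν x)
    (hν : ∀ᵐ x, HasGradientAt g (ν x) x)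
    {φ : Euc d → Euc d} (hφ : ContDiff ℝ 1 φ) (hφc : HasCompactSupport φ) :
    ∫ x in {x | g x < 1}, vdiv φ x
      = d * ∫ x in {x | g x < 1}, ⟪ν x, φ ((g x)⁻¹ • x)⟫ := by
  have hgm : Measurable g := hg.continuous.measurable
  have hB : 0 ≤ B := (norm_nonneg _).trans (hνB 0)
  set G : Euc d → ℝ := fun x => ⟪ν x, φ ((g x)⁻¹ • x)⟫ with hGdef
  have hGhom : ∀ t : ℝ, 0 < t → ∀ x, G (t • x) = G x := by
    intro t ht x
    simp only [hGdef, hνhom t ht, hhom t ht, smul_smul]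
    congr 3
    field_simp
  obtain ⟨D, hD⟩ := hφ.lipschitzWith_of_hasCompactSupport hφc one_ne_zero
  obtain ⟨S, hS⟩ := hφ.continuous.bounded_above_of_compact_support hφc
  have hGm : Measurable G := by
    have := hφ.continuous.measurable
    fun_prop
  have hfin : ∀ t : ℝ, volume {x | g x < t} < ⊤ := fun t =>
    (isBounded_sublevel hc hgc t).measure_lt_top
  have hGb : ∀ x, ‖G x‖ ≤ B * S := fun x =>
    (norm_inner_le_norm _ _).trans (mul_le_mul (hνB x) (hS _) (norm_nonneg _) hB)
  have hGint : ∀ t : ℝ, IntegrableOn G {x | g x < t} := fun t =>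
    Measure.integrableOn_of_bounded (hfin t).ne hGm.aestronglyMeasurable (.of_forall hGb)
  have hms : ∀ t : ℝ, MeasurableSet {x | g x < t} := fun t => measurableSet_lt hgm measurable_const
  have hshell : ∀ ε : ℝ, 0 < ε →
      {x | 1 - ε ≤ g x ∧ g x < 1} = {x | g x < 1} \ {x | g x < 1 - ε} := by
    intro ε hε; ext x; simp [and_comm]
  have hshellm : ∀ ε : ℝ, MeasurableSet {x | 1 - ε ≤ g x ∧ g x < 1} := fun ε =>
      (measurableSet_le measurable_const hgm).inter (measurableSet_lt hgm measurable_const)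
  have hfilt : ∀ᶠ ε : ℝ in 𝓝[>] 0, 0 < ε ∧ ε < 1 := Ioo_mem_nhdsGT zero_lt_one
  have hL : Tendsto (fun ε : ℝ => ∫ x, max 0 (min 1 ((1 - g x) / ε)) * vdiv φ x) (𝓝[>] 0)
      (𝓝 (∫ x in {x | g x < 1}, vdiv φ x)) := by
    rw [← integral_indicator (hms 1)]
    refine tendsto_integral_filter_of_dominated_convergence (fun x => ‖vdiv φ x‖) ?_ ?_
      (integrable_vdiv hφ hφc).norm ?_
    · refine .of_forall fun ε => ?_
      have := (continuous_vdiv hφ).measurable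
      exact Measurable.aestronglyMeasurable (by fun_prop)
    · refine .of_forall fun ε => .of_forall fun x => ?_
      rw [norm_mul, Real.norm_eq_abs, abs_of_nonneg (le_max_left _ _)]
      refine mul_le_of_le_one_left (norm_nonneg _) (max_le zero_le_one (min_le_left _ _))
    · refine .of_forall fun x => tendsto_const_nhds.congr' ?_
      by_cases hx : g x < 1
      · filter_upwards [Ioo_mem_nhdsGT (sub_pos.2 hx)] with ε hε
        have : 1 ≤ (1 - g x) / ε := by rw [le_div_iff₀ hε.1]; linarith [hε.2]
        rw [indicator_of_mem (by exact hx)]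
        simp [this]
      · filter_upwards [hfilt] with ε hε
        have : (1 - g x) / ε ≤ 0 := div_nonpos_of_nonpos_of_nonneg (by linarith) hε.1.le
        rw [indicator_of_notMem (by exact hx)]
        simp [this]
  have hq : Tendsto (fun ε : ℝ => ε⁻¹ * (1 - (1 - ε) ^ d)) (𝓝[>] 0) (𝓝 d) := by
    have h1 : HasDerivAt (fun ε : ℝ => -(1 - ε) ^ d) d 0 := by
      have := (((hasDerivAt_id (0 : ℝ)).const_sub 1).pow d).neg
      convert! this using 1
      simp
    have h2 := h1.tendsto_slope_zero_right
    refine h2.congr fun ε => ?_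
    simp
    left; ring
  have hmain : Tendsto (fun ε : ℝ => ε⁻¹ * ∫ x in {x | 1 - ε ≤ g x ∧ g x < 1}, G x) (𝓝[>] 0)
      (𝓝 (d * ∫ x in {x | g x < 1}, G x)) := by
    refine (hq.mul_const _).congr' ?_
    filter_upwards [hfilt] with ε hε
    rw [hshell ε hε.1, setIntegral_sdiff (hms _) (hGint 1)
      (fun x (hx : g x < 1 - ε) => show g x < 1 by linarith [hε.1]),
      setIntegral_sublevel hhom hGhom (sub_pos.2 hε.2)]
    ring
  have herr : Tendsto (fun ε : ℝ => ε⁻¹ * ∫ x in {x | 1 - ε ≤ g x ∧ g x < 1}, (⟪ν x, φ x⟫ - G x))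
      (𝓝[>] 0) (𝓝 0) := by
    have hup : Tendsto (fun ε : ℝ => (B * D / c) * ((1 - (1 - ε) ^ d) * volume.real {x | g x < 1}))
        (𝓝[>] 0) (𝓝 0) := by
      have : Continuous fun ε : ℝ =>
        (B * D / c) * ((1 - (1 - ε) ^ d) * volume.real {x | g x < 1}) := by fun_prop
      simpa using (this.tendsto 0).mono_left nhdsWithin_le_nhds
    refine squeeze_zero_norm' ?_ hup
    filter_upwards [hfilt] with ε hε
    have hvol : volume.real {x | 1 - ε ≤ g x ∧ g x < 1}
        = (1 - (1 - ε) ^ d) * volume.real {x | g x < 1} := by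
      have hsub : {x | g x < 1 - ε} ⊆ {x | g x < 1} :=
        fun x (hx : g x < 1 - ε) => show g x < 1 by linarith [hε.1]
      have h1 := setIntegral_sublevel hhom (G := fun _ => 1) (fun _ _ _ => rfl) (sub_pos.2 hε.2)
      simp only [setIntegral_const, smul_eq_mul, mul_one] at h1
      rw [hshell ε hε.1, measureReal_sdiff hsub (hms _) (hfin _).ne, h1]
      ring
    have hb : ∀ x ∈ {x | 1 - ε ≤ g x ∧ g x < 1}, ‖⟪ν x, φ x⟫ - G x‖ ≤ B * D / c * ε := by
      rintro x ⟨hx1, hx2⟩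
      have hgx : 0 < g x := by linarith [hε.2]
      have h1 : ‖φ x - φ ((g x)⁻¹ • x)‖ ≤ D * (ε / c) := by
        rw [← dist_eq_norm]
        refine (hD.dist_le_mul _ _).trans (mul_le_mul_of_nonneg_left ?_ D.2)
        rw [dist_eq_norm]
        have : x - (g x)⁻¹ • x = (1 - (g x)⁻¹) • x := by rw [sub_smul, one_smul]
        rw [this, norm_smul, Real.norm_eq_abs, abs_of_nonpos (by
          have := (one_le_inv₀ hgx).2 hx2.le
          linarith)]
        have h2 : ‖x‖ ≤ g x / c := by rw [le_div_iff₀ hc]; linarith [hgc x]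
        have h3 : 0 ≤ -(1 - (g x)⁻¹) := by
          have := (one_le_inv₀ hgx).2 hx2.le
          linarith
        calc -(1 - (g x)⁻¹) * ‖x‖ ≤ -(1 - (g x)⁻¹) * (g x / c) := by gcongr
          _ = (1 - g x) / c := by field_simp; ring
          _ ≤ ε / c := by gcongr; linarith
      rw [hGdef, ← inner_sub_right]
      refine (norm_inner_le_norm _ _).trans ?_
      calc ‖ν x‖ * ‖φ x - φ ((g x)⁻¹ • x)‖ ≤ B * (D * (ε / c)) :=
            mul_le_mul (hνB x) h1 (norm_nonneg _) hB
        _ = B * D / c * ε := by ring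
    rw [norm_mul, norm_inv, Real.norm_eq_abs, abs_of_pos hε.1]
    have hlt : volume {x | 1 - ε ≤ g x ∧ g x < 1} < ⊤ :=
      (measure_mono (fun x hx => hx.2)).trans_lt (hfin 1)
    have h4 := norm_setIntegral_le_of_norm_le_const hlt hb
    rw [hvol] at h4
    calc ε⁻¹ * _ ≤ ε⁻¹ * (B * D / c * ε * ((1 - (1 - ε) ^ d) * volume.real {x | g x < 1})) := by
          gcongr
          exact inv_nonneg.2 hε.1.le
      _ = _ := by field_simp [hε.1.ne']
  have hsum := hmain.add herr
  rw [add_zero] at hsum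
  refine tendsto_nhds_unique hL (hsum.congr' ?_)
  filter_upwards [hfilt] with ε hε
  rw [integral_cutoff_mul_vdiv hg hconv hhom hν hφ hφc hε.1 hε.2, ← mul_add, ← integral_add]
  · simp
  · rw [hshell ε hε.1]; exact (hGint 1).mono_set sdiff_subset
  · refine Integrable.sub ?_ (by rw [hshell ε hε.1]; exact (hGint 1).mono_set sdiff_subset)
    refine Measure.integrableOn_of_bounded (M := B * S)
      ((measure_mono (fun x hx => hx.2)).trans_lt (hfin 1)).ne ?_ (.of_forall fun x => ?_)
    · have := hφ.continuous.measurable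
      exact Measurable.aestronglyMeasurable (by fun_prop)
    · exact (norm_inner_le_norm _ _).trans (mul_le_mul (hνB x) (hS _) (norm_nonneg _) hB)

end GaussGreen

/-- The test fields in the definition of the perimeter relative to an open set `U`. -/
structure IsTestField {d : ℕ} (U : Set (Euc d)) (φ : Euc d → Euc d) : Prop where
  contDiff : ContDiff ℝ 1 φ
  hasCompactSupport : HasCompactSupport φ
  tsupport_subset : tsupport φ ⊆ U
  norm_le : ∀ x, ‖φ x‖ ≤ 1

theorem IsTestField.eq_zero {d : ℕ} {U : Set (Euc d)} {φ : Euc d → Euc d} (h : IsTestField U φ)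
    {x : Euc d} (hx : x ∉ U) : φ x = 0 :=
  image_eq_zero_of_notMem_tsupport fun h' => hx (h.tsupport_subset h')

theorem IsTestField.mono {d : ℕ} {U V : Set (Euc d)} {φ : Euc d → Euc d} (h : IsTestField U φ)
    (hUV : U ⊆ V) : IsTestField V φ :=
  ⟨h.1, h.2, h.3.trans hUV, h.4⟩

theorem perim_eq_ofReal {d : ℕ} {E U : Set (Euc d)} (hU : IsOpen U) {a : ℝ}
    (hub : ∀ φ, IsTestField U φ → ∫ x in E, vdiv φ x ≤ a)
    {φ : ℕ → Euc d → Euc d} (hφ : ∀ k, IsTestField U (φ k))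
    (hlim : Tendsto (fun k => ∫ x in E, vdiv (φ k) x) atTop (𝓝 a)) :
    perim E U = ENNReal.ofReal a := by
  refine le_antisymm ?_ ?_
  · refine iInf₂_le_of_le U hU (iInf_le_of_le subset_rfl ?_)
    exact iSup_le fun ψ => iSup₂_le fun h1 h2 => iSup₂_le fun h3 h4 =>
      ENNReal.ofReal_le_ofReal (hub ψ ⟨h1, h2, h3, h4⟩)
  · refine le_iInf₂ fun V _ => le_iInf fun hUV => ?_
    refine le_of_tendsto (ENNReal.tendsto_ofReal hlim) (.of_forall fun k => ?_)
    exact le_iSup_of_le (φ k) (le_iSup₂_of_le (hφ k).1 (hφ k).2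
      (le_iSup₂_of_le ((hφ k).3.trans hUV) (hφ k).4 le_rfl))

theorem perim_congr_ae {d : ℕ} {E F U : Set (Euc d)} (h : E =ᵐ[volume] F) :
    perim E U = perim F U := by
  simp only [perim, setIntegral_congr_set h]

theorem perim_empty {d : ℕ} (U : Set (Euc d)) : perim (∅ : Set (Euc d)) U = 0 := by
  refine nonpos_iff_eq_zero.1 (iInf₂_le_of_le univ isOpen_univ (iInf_le_of_le (subset_univ _) ?_))
  simp

open scoped Manifold ContDiff in
/-- A smooth unit field on an open set `W` is a pointwise limit of test fields in `W`. -/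
theorem exists_seq_isTestField {d : ℕ} {W : Set (Euc d)} (hW : IsOpen W) {N : Euc d → Euc d}
    (hN : ContDiffOn ℝ 1 N W) (hN1 : ∀ x ∈ W, ‖N x‖ ≤ 1) :
    ∃ φ : ℕ → Euc d → Euc d, (∀ k, IsTestField W (φ k)) ∧
      ∀ x ∈ W, Tendsto (fun k => φ k x) atTop (𝓝 (N x)) := by
  obtain ⟨F, hFc, hFW, hFU, hFm⟩ := hW.exists_iUnion_isClosed
  have hK : ∀ k : ℕ, IsCompact (F k ∩ closedBall 0 k) := fun k =>
    (isCompact_closedBall 0 (k : ℝ)).inter_left (hFc k)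
  have hex : ∀ k : ℕ, ∃ ψ : Euc d → Euc d, IsTestField W ψ ∧
      ∀ x ∈ F k ∩ closedBall 0 k, ψ x = N x := by
    intro k
    obtain ⟨L, hL, hKL, hLW⟩ := exists_compact_between (hK k) hW
      (inter_subset_left.trans (hFW k))
    obtain ⟨f, hf1, hf0, hf⟩ := exists_contMDiffMap_one_nhds_of_subset_interior (n := 1)
      (I := 𝓘(ℝ, Euc d)) (hK k).isClosed hKL
    have hfs : ContDiff ℝ 1 f := f.contMDiff.contDiff
    have hts : tsupport (fun x => f x • N x) ⊆ L := by
      refine closure_minimal (fun x hx => ?_) hL.isClosed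
      by_contra h
      exact hx (by simp [hf0 x h])
    refine ⟨fun x => f x • N x, ⟨?_, ?_, hts.trans hLW, fun x => ?_⟩, fun x hx => ?_⟩
    · refine contDiff_iff_contDiffAt.2 fun x => ?_
      by_cases hx : x ∈ W
      · exact hfs.contDiffAt.smul (hN.contDiffAt (hW.mem_nhds hx))
      · refine (contDiffAt_const (c := (0 : Euc d))).congr_of_eventuallyEq ?_
        filter_upwards [hL.isClosed.isOpen_compl.mem_nhds fun h => hx (hLW h)] with y hy
        simp [hf0 y hy]
    · exact hL.of_isClosed_subset (isClosed_tsupport _) hts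
    · by_cases hx : x ∈ W
      · rw [norm_smul, Real.norm_eq_abs, abs_of_nonneg (hf x).1]
        exact mul_le_one₀ (hf x).2 (norm_nonneg _) (hN1 x hx)
      · simp [hf0 x fun h => hx (hLW h)]
    · simp [hf1.self_of_nhdsSet x hx]
  choose φ hφ hφN using hex
  refine ⟨φ, hφ, fun x hx => tendsto_const_nhds.congr' ?_⟩
  rw [← hFU] at hx
  obtain ⟨m, hm⟩ := mem_iUnion.1 hx
  obtain ⟨l, hl⟩ := exists_nat_ge ‖x‖
  filter_upwards [eventually_ge_atTop (max m l)] with k hk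
  refine (hφN k x ⟨hFm ((le_max_left _ _).trans hk) hm, ?_⟩).symm
  rw [mem_closedBall_zero_iff]
  exact hl.trans (by exact_mod_cast (le_max_right _ _).trans hk)

section Flux

variable {d : ℕ} {ν π : Euc d → Euc d} {B : ℝ}

theorem integrableOn_flux (hν : Measurable ν) (hνB : ∀ x, ‖ν x‖ ≤ B) (hπ : Measurable π)
    {S : Set (Euc d)} (hS : volume S ≠ ⊤) {φ : Euc d → Euc d} (hφ : Continuous φ)
    (hφc : HasCompactSupport φ) : IntegrableOn (fun v => ⟪ν v, φ (π v)⟫) S := by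
  obtain ⟨D, hD⟩ := hφ.bounded_above_of_compact_support hφc
  have hm := hφ.measurable
  refine Measure.integrableOn_of_bounded (M := B * D) hS
    (Measurable.aestronglyMeasurable (by fun_prop)) (.of_forall fun v => ?_)
  exact (norm_inner_le_norm _ _).trans (mul_le_mul (hνB v) (hD _) (norm_nonneg _)
    ((norm_nonneg _).trans (hνB 0)))

/-- If the test fields converge to a field dual to `ν` on the part of the boundary inside `W`,
then the fluxes converge to the total area of this part. -/
theorem tendsto_flux (hν : Measurable ν) (hνB : ∀ x, ‖ν x‖ ≤ B) (hπ : Measurable π)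
    {S T W : Set (Euc d)} (hS : volume S ≠ ⊤) (hSm : MeasurableSet S) (hT : MeasurableSet T)
    {φ : ℕ → Euc d → Euc d} (hφ : ∀ k, IsTestField W (φ k)) {N : Euc d → Euc d}
    (hlim : ∀ x ∈ W, Tendsto (fun k => φ k x) atTop (𝓝 (N x))) {w : ℝ}
    (h1 : ∀ᵐ v, v ∈ S → v ∈ T → π v ∈ W ∧ ⟪ν v, N (π v)⟫ = w)
    (h2 : ∀ᵐ v, v ∈ S → v ∉ T → π v ∉ W) :
    Tendsto (fun k => ∫ v in S, ⟪ν v, φ k (π v)⟫) atTop (𝓝 (w * volume.real (S ∩ T))) := by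
  have hB : 0 ≤ B := (norm_nonneg _).trans (hνB 0)
  have hval : w * volume.real (S ∩ T) = ∫ v in S, T.indicator (fun _ => w) v := by
    rw [setIntegral_indicator hT]
    simp [mul_comm]
  rw [hval]
  refine tendsto_integral_of_dominated_convergence (fun _ => B * 1) (fun k => ?_)
    (integrableOn_const hS) (fun k => .of_forall fun v => ?_) ?_
  · have := (hφ k).1.continuous.measurable
    exact Measurable.aestronglyMeasurable (by fun_prop)
  · exact (norm_inner_le_norm _ _).trans (mul_le_mul (hνB v) ((hφ k).4 _) (norm_nonneg _) hB)
  · rw [ae_restrict_iff' hSm]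
    filter_upwards [h1, h2] with v h1 h2 hv
    by_cases hvT : v ∈ T
    · rw [indicator_of_mem hvT, ← (h1 hv hvT).2]
      exact tendsto_const_nhds.inner (hlim _ (h1 hv hvT).1)
    · rw [indicator_of_notMem hvT]
      refine tendsto_const_nhds.congr fun k => ?_
      rw [(hφ k).eq_zero (h2 hv hvT), inner_zero_right]

theorem abs_flux_le (hνB : ∀ x, ‖ν x‖ ≤ B) {S T U : Set (Euc d)} (hS : volume S ≠ ⊤)
    (hSm : MeasurableSet S) {φ : Euc d → Euc d} (hφ : IsTestField U φ)
    (h : ∀ v ∈ S, v ∉ T → π v ∉ U) :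
    |∫ v in S, ⟪ν v, φ (π v)⟫| ≤ B * volume.real (S ∩ T) := by
  have h1 : ∫ v in S, ⟪ν v, φ (π v)⟫ = ∫ v in S ∩ T, ⟪ν v, φ (π v)⟫ := by
    refine setIntegral_eq_of_subset_of_forall_sdiff_eq_zero hSm inter_subset_left fun v hv => ?_
    rw [hφ.eq_zero (h v hv.1 fun hT => hv.2 ⟨hv.1, hT⟩), inner_zero_right]
  rw [h1, ← Real.norm_eq_abs]
  refine norm_setIntegral_le_of_norm_le_const
    ((measure_mono inter_subset_left).trans_lt hS.lt_top) fun v _ => ?_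
  exact ((norm_inner_le_norm _ _).trans (mul_le_mul (hνB v) (hφ.4 _) (norm_nonneg _)
    ((norm_nonneg _).trans (hνB 0)))).trans_eq (mul_one B)

end Flux

section Chart

variable {d : ℕ}

/-- The linear function of slope `2 / ‖n‖` in direction `n`, equal to `1` on the perpendicular
bisector of `0` and `n`. -/
def bisector (n v : Euc d) : ℝ := 2 / ‖n‖ ^ 2 * ⟪n, v⟫

@[fun_prop]
theorem continuous_bisector (n : Euc d) : Continuous (bisector n) := by
  unfold bisector; fun_prop

theorem bisector_smul (n v : Euc d) (t : ℝ) : bisector n (t • v) = t * bisector n v := by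
  simp only [bisector, inner_smul_right]; ring

theorem bisector_sub (n v w : Euc d) : bisector n (v - w) = bisector n v - bisector n w := by
  simp only [bisector, inner_sub_right]; ring

theorem bisector_self {n : Euc d} (hn : n ≠ 0) : bisector n n = 2 := by
  have := norm_ne_zero_iff.2 hn
  rw [bisector, real_inner_self_eq_norm_sq]
  field_simp

theorem hasGradientAt_bisector (n v : Euc d) :
    HasGradientAt (bisector n) ((2 / ‖n‖ ^ 2) • n) v := by
  rw [hasGradientAt_iff_hasFDerivAt]
  have := ((innerSL ℝ n).hasFDerivAt (x := v)).const_mul (2 / ‖n‖ ^ 2)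
  convert! this using 1
  simp
  rfl

theorem hasGradientAt_norm_div {M : ℝ} {v : Euc d} (hv : v ≠ 0) :
    HasGradientAt (fun v : Euc d => ‖v‖ / M) ((M * ‖v‖)⁻¹ • v) v := by
  rw [hasGradientAt_iff_hasFDerivAt]
  have h := ((hasStrictFDerivAt_norm_sq v).hasFDerivAt.sqrt
    (by simpa using hv)).mul_const M⁻¹
  have hn := norm_ne_zero_iff.2 hv
  simp only [Real.sqrt_sq (norm_nonneg _)] at h
  convert! h using 1
  ext w
  simp
  field_simp

theorem lipschitzWith_norm_div {M : ℝ} (hM : 0 < M) :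
    LipschitzWith (Real.toNNReal M⁻¹) fun v : Euc d => ‖v‖ / M := by
  refine LipschitzWith.of_dist_le_mul fun x y => ?_
  rw [Real.dist_eq, ← sub_div, abs_div, abs_of_pos hM, Real.coe_toNNReal _ (inv_pos.2 hM).le,
    div_eq_inv_mul, dist_eq_norm]
  gcongr
  exact abs_norm_sub_norm_le x y

theorem lipschitzWith_bisector (n : Euc d) : ∃ K : NNReal, LipschitzWith K (bisector n) := by
  refine ⟨‖(2 / ‖n‖ ^ 2) • innerSL ℝ n‖₊, fun x y => ?_⟩
  exact ((2 / ‖n‖ ^ 2) • innerSL ℝ n).lipschitz x y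

theorem convexOn_norm_div {M : ℝ} (hM : 0 < M) :
    ConvexOn ℝ univ fun v : Euc d => ‖v‖ / M := by
  simpa [div_eq_inv_mul] using (convexOn_univ_norm (E := Euc d)).smul (inv_pos.2 hM).le

theorem convexOn_bisector (n : Euc d) : ConvexOn ℝ univ (bisector n) := by
  refine ⟨convex_univ, fun x _ y _ a b _ _ _ => le_of_eq ?_⟩
  simp only [bisector, inner_add_right, inner_smul_right, smul_eq_mul]
  ring

/-- The cone where the two parts of the gauge `max (‖v‖ / M) (bisector n v)` agree is null. -/
theorem ae_norm_div_ne_bisector {n : Euc d} (hn : n ≠ 0) {M : ℝ} (hM : ‖n‖ ≤ M) :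
    ∀ᵐ v, ‖v‖ / M ≠ bisector n v := by
  have hn0 : 0 < ‖n‖ := norm_pos_iff.2 hn
  have hM0 : 0 < M := hn0.trans_le hM
  have hconv : Convex ℝ {v : Euc d | ‖v‖ / M + bisector (-n) v ≤ 0} := by
    simpa using ((convexOn_norm_div hM0).add (convexOn_bisector (-n))).convex_le 0
  have hneg : ∀ v, bisector (-n) v = - bisector n v := fun v => by simp [bisector]
  refine measure_mono_null (fun v hv => ?_) (hconv.addHaar_frontier volume)
  have hv : ‖v‖ / M = bisector n v := by simpa using hv
  refine ⟨subset_closure (by simp [hneg, hv]), fun h => ?_⟩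
  have h1 : Tendsto (fun δ : ℝ => v - δ • n) (𝓝[>] 0) (𝓝 v) := by
    have : Continuous fun δ : ℝ => v - δ • n := by fun_prop
    simpa using (this.tendsto 0).mono_left nhdsWithin_le_nhds
  obtain ⟨δ, hδ, hδ0⟩ := ((h1.eventually (mem_interior_iff_mem_nhds.1 h)).and
    self_mem_nhdsWithin).exists
  have h2 : ‖v - δ • n‖ / M - (bisector n v - δ * 2) ≤ 0 := by
    have h3 : ‖v - δ • n‖ / M + bisector (-n) (v - δ • n) ≤ 0 := hδ
    rw [hneg, bisector_sub, bisector_smul, bisector_self hn] at h3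
    linarith
  have h4 : ‖v‖ - δ * ‖n‖ ≤ ‖v - δ • n‖ := by
    have := norm_sub_norm_le v (δ • n)
    rwa [norm_smul, Real.norm_eq_abs, abs_of_pos hδ0] at this
  have h5 : ‖v‖ / M - δ ≤ ‖v - δ • n‖ / M := by
    rw [div_sub' hM0.ne']
    gcongr
    nlinarith
  linarith

/-- The gauge of the truncated half-space `{v | ‖v‖ < M, bisector n v < 1}`. -/
def halfGauge (n : Euc d) (M : ℝ) (v : Euc d) : ℝ := max (‖v‖ / M) (bisector n v)

open Classical in
/-- The almost everywhere gradient of `halfGauge n M`. -/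
def halfGrad (n : Euc d) (M : ℝ) (v : Euc d) : Euc d :=
  if ‖v‖ / M < bisector n v then (2 / ‖n‖ ^ 2) • n else (M * ‖v‖)⁻¹ • v

theorem norm_radial_le {M : ℝ} (hM : 0 < M) (v : Euc d) : ‖(M * ‖v‖)⁻¹ • v‖ ≤ M⁻¹ := by
  rw [norm_smul, norm_inv, norm_mul, norm_norm, Real.norm_eq_abs, abs_of_pos hM, mul_inv, mul_assoc]
  refine mul_le_of_le_one_right (inv_pos.2 hM).le ?_
  rw [inv_mul_eq_div]
  exact div_self_le_one _

theorem radial_smul {M t : ℝ} (ht : 0 < t) (v : Euc d) :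
    (M * ‖t • v‖)⁻¹ • t • v = (M * ‖v‖)⁻¹ • v := by
  rw [smul_smul, norm_smul, Real.norm_eq_abs, abs_of_pos ht]
  congr 1
  rcases eq_or_ne ‖v‖ 0 with h | h
  · simp [h]
  · rcases eq_or_ne M 0 with h' | h'
    · simp [h']
    · field_simp

theorem gauss_green_ball (hd : d ≠ 0) {M : ℝ} (hM : 0 < M) {φ : Euc d → Euc d}
    (hφ : ContDiff ℝ 1 φ) (hφc : HasCompactSupport φ) :
    ∫ v in {v : Euc d | ‖v‖ < M}, vdiv φ v
      = d * ∫ v in {v : Euc d | ‖v‖ < M}, ⟪(M * ‖v‖)⁻¹ • v, φ ((M / ‖v‖) • v)⟫ := by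
  have : NeZero d := ⟨hd⟩
  have h := gauss_green (g := fun v : Euc d => ‖v‖ / M) (ν := fun v => (M * ‖v‖)⁻¹ • v)
    (lipschitzWith_norm_div hM) (convexOn_norm_div hM)
    (fun t ht x => by simp only [norm_smul, Real.norm_eq_abs, abs_of_pos ht]; ring)
    (inv_pos.2 hM) (fun x => (inv_mul_eq_div _ _).le) (by fun_prop) (norm_radial_le hM)
    (fun t ht x => radial_smul ht x)
    (by filter_upwards [Measure.ae_ne volume (0 : Euc d)] with v hv using hasGradientAt_norm_div hv)
    hφ hφc
  simpa only [div_lt_one hM, inv_div] using h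

theorem gauss_green_half (hd : d ≠ 0) {n : Euc d} (hn : n ≠ 0) {M : ℝ} (hM : ‖n‖ ≤ M)
    {φ : Euc d → Euc d} (hφ : ContDiff ℝ 1 φ) (hφc : HasCompactSupport φ) :
    ∫ v in {v | ‖v‖ < M ∧ bisector n v < 1}, vdiv φ v
      = (d * ∫ v in {v | ‖v‖ / M < bisector n v ∧ bisector n v < 1},
            ⟪(2 / ‖n‖ ^ 2) • n, φ ((bisector n v)⁻¹ • v)⟫)
        + d * ∫ v in {v | ‖v‖ < M ∧ bisector n v ≤ ‖v‖ / M},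
            ⟪(M * ‖v‖)⁻¹ • v, φ ((M / ‖v‖) • v)⟫ := by
  have : NeZero d := ⟨hd⟩
  have hn0 : 0 < ‖n‖ := norm_pos_iff.2 hn
  have hM0 : 0 < M := hn0.trans_le hM
  have hcone : MeasurableSet {v : Euc d | ‖v‖ / M < bisector n v} :=
    (isOpen_lt (by fun_prop) (by fun_prop)).measurableSet
  have hνm : Measurable (halfGrad n M) := by
    unfold halfGrad
    exact Measurable.ite hcone measurable_const (by fun_prop)
  have hνB : ∀ v, ‖halfGrad n M v‖ ≤ max ‖(2 / ‖n‖ ^ 2) • n‖ M⁻¹ := by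
    intro v
    unfold halfGrad
    split_ifs
    · exact le_max_left _ _
    · exact (norm_radial_le hM0 v).trans (le_max_right _ _)
  obtain ⟨K, hK⟩ := lipschitzWith_bisector n
  have hlip := (lipschitzWith_norm_div (d := d) hM0).max hK
  have hgrad : ∀ᵐ v, HasGradientAt (halfGauge n M) (halfGrad n M v) v := by
    filter_upwards [Measure.ae_ne volume (0 : Euc d), ae_norm_div_ne_bisector hn hM] with v hv hv'
    rcases lt_or_gt_of_ne hv' with h | h
    · rw [halfGrad, if_pos h]
      refine (hasGradientAt_bisector n v).congr_of_eventuallyEq ?_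
      have hc : Continuous fun v : Euc d => ‖v‖ / M := by fun_prop
      filter_upwards [hc.continuousAt.eventually_lt (continuous_bisector n).continuousAt h]
        with y hy
      exact max_eq_right hy.le
    · rw [halfGrad, if_neg (not_lt.2 h.le)]
      refine (hasGradientAt_norm_div hv).congr_of_eventuallyEq ?_
      have hc : Continuous fun v : Euc d => ‖v‖ / M := by fun_prop
      filter_upwards [(continuous_bisector n).continuousAt.eventually_lt hc.continuousAt h]
        with y hy
      exact max_eq_left hy.le
  have hhom : ∀ t : ℝ, 0 < t → ∀ x, halfGauge n M (t • x) = t * halfGauge n M x := by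
    intro t ht x
    rw [halfGauge, halfGauge, bisector_smul, norm_smul, Real.norm_eq_abs, abs_of_pos ht,
      mul_div_assoc, mul_max_of_nonneg _ _ ht.le]
  have hνhom : ∀ t : ℝ, 0 < t → ∀ x, halfGrad n M (t • x) = halfGrad n M x := by
    intro t ht x
    simp only [halfGrad]
    rw [radial_smul ht, bisector_smul, norm_smul, Real.norm_eq_abs, abs_of_pos ht,
      mul_div_assoc]
    simp only [mul_lt_mul_iff_right₀ ht]
  have h := gauss_green (g := halfGauge n M) (ν := halfGrad n M) hlip
    ((convexOn_norm_div hM0).sup (convexOn_bisector n)) hhom (inv_pos.2 hM0)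
    (fun x => (inv_mul_eq_div _ _).le.trans (le_max_left _ _)) hνm hνB hνhom hgrad hφ hφc
  have hset : {v | halfGauge n M v < 1} = {v | ‖v‖ < M ∧ bisector n v < 1} := by
    ext v; simp [halfGauge, div_lt_one hM0]
  rw [hset] at h
  have hb : volume {v : Euc d | ‖v‖ < M ∧ bisector n v < 1} ≠ ⊤ := by
    refine ((measure_mono (fun v hv => ?_)).trans_lt (measure_ball_lt_top (x := (0 : Euc d))
      (r := M))).ne
    exact mem_ball_zero_iff.2 hv.1
  have hsm : Measurable fun v => (halfGauge n M v)⁻¹ • v := by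
    unfold halfGauge
    have := (continuous_bisector n).measurable
    fun_prop
  have hint := integrableOn_flux hνm hνB hsm hb hφ.continuous hφc
  rw [h, ← integral_inter_add_sdiff hcone hint, mul_add]
  have e1 : {v | ‖v‖ < M ∧ bisector n v < 1} ∩ {v | ‖v‖ / M < bisector n v}
      = {v | ‖v‖ / M < bisector n v ∧ bisector n v < 1} := by
    ext v
    simp only [mem_inter_iff, mem_ofPred_eq]
    refine ⟨fun h => ⟨h.2, h.1.2⟩, fun h => ⟨⟨?_, h.2⟩, h.1⟩⟩
    exact (div_lt_one hM0).1 (h.1.trans h.2)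
  have e2 : {v | ‖v‖ < M ∧ bisector n v < 1} \ {v | ‖v‖ / M < bisector n v}
      = {v | ‖v‖ < M ∧ bisector n v ≤ ‖v‖ / M} := by
    ext v
    simp only [Set.mem_sdiff, mem_ofPred_eq, not_lt]
    refine ⟨fun h => ⟨h.1.1, h.2⟩, fun h => ⟨⟨h.1, ?_⟩, h.2⟩⟩
    exact h.2.trans_lt ((div_lt_one hM0).2 h.1)
  rw [e1, e2]
  have i1 : ∫ v in {v | ‖v‖ / M < bisector n v ∧ bisector n v < 1},
        ⟪halfGrad n M v, φ ((halfGauge n M v)⁻¹ • v)⟫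
      = ∫ v in {v | ‖v‖ / M < bisector n v ∧ bisector n v < 1},
        ⟪(2 / ‖n‖ ^ 2) • n, φ ((bisector n v)⁻¹ • v)⟫ := by
    have := (continuous_bisector n).measurable
    refine setIntegral_congr_fun ?_ fun v hv => ?_
    · exact hcone.inter (measurableSet_lt this measurable_const)
    · simp only [halfGrad, halfGauge]
      rw [if_pos hv.1, max_eq_right hv.1.le]
  have i2 : ∫ v in {v | ‖v‖ < M ∧ bisector n v ≤ ‖v‖ / M},
        ⟪halfGrad n M v, φ ((halfGauge n M v)⁻¹ • v)⟫
      = ∫ v in {v | ‖v‖ < M ∧ bisector n v ≤ ‖v‖ / M},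
        ⟪(M * ‖v‖)⁻¹ • v, φ ((M / ‖v‖) • v)⟫ := by
    have := (continuous_bisector n).measurable
    refine setIntegral_congr_fun ?_ fun v hv => ?_
    · exact (measurableSet_lt measurable_norm measurable_const).inter
        (measurableSet_le this (measurable_norm.div_const M))
    · simp only [halfGrad, halfGauge]
      rw [if_neg (not_lt.2 hv.2), max_eq_left hv.2, inv_div]
  rw [i1, i2]

end Chart

section Lens

variable {d : ℕ}

/-- The flux through the part of the sphere of radius `‖n‖` beyond the bisector of `0` and `n`. -/
def capFlux (n : Euc d) (φ : Euc d → Euc d) : ℝ :=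
  d * ∫ v in {v | ‖v‖ < ‖n‖ ∧ ‖v‖ / ‖n‖ < bisector n v},
    ⟪(‖n‖ * ‖v‖)⁻¹ • v, φ ((‖n‖ / ‖v‖) • v)⟫

/-- The flux through the part of the bisector of `0` and `n` spanned by the cone over `S`. -/
def planeFlux (n : Euc d) (S : Set (Euc d)) (φ : Euc d → Euc d) : ℝ :=
  d * ∫ v in S, ⟪(2 / ‖n‖ ^ 2) • n, φ ((bisector n v)⁻¹ • v)⟫

/-- The cone over the part of the bisector of `0` and `n` inside the ball of radius `M`. -/
def discCone (n : Euc d) (M : ℝ) : Set (Euc d) :=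
  {v | ‖v‖ / M < bisector n v ∧ bisector n v < 1}

theorem measurableSet_discCone (n : Euc d) (M : ℝ) : MeasurableSet (discCone n M) :=
  have h := (continuous_bisector n).measurable
  (measurableSet_lt (measurable_norm.div_const M) h).inter (measurableSet_lt h measurable_const)

theorem volume_discCone_ne_top (n : Euc d) {M : ℝ} (hM : 0 < M) :
    volume (discCone n M) ≠ ⊤ := by
  refine ((measure_mono (fun v hv => ?_)).trans_lt (measure_ball_lt_top (x := (0 : Euc d))
    (r := M))).ne
  exact mem_ball_zero_iff.2 ((div_lt_one hM).1 (hv.1.trans hv.2))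

theorem discCone_subset (n : Euc d) {M M' : ℝ} (hM : 0 < M) (h : M ≤ M') :
    discCone n M ⊆ discCone n M' := fun v hv =>
  ⟨(div_le_div_of_nonneg_left (norm_nonneg v) hM h).trans_lt hv.1, hv.2⟩

theorem integrableOn_planeFlux (n : Euc d) {S : Set (Euc d)} (hS : volume S ≠ ⊤)
    {φ : Euc d → Euc d} (hφ : ContDiff ℝ 1 φ) (hφc : HasCompactSupport φ) :
    IntegrableOn (fun v => ⟪(2 / ‖n‖ ^ 2) • n, φ ((bisector n v)⁻¹ • v)⟫) S := by
  have := (continuous_bisector n).measurable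
  exact integrableOn_flux (ν := fun _ => (2 / ‖n‖ ^ 2) • n) measurable_const (fun _ => le_rfl)
    (π := fun v => (bisector n v)⁻¹ • v) (by fun_prop) hS hφ.continuous hφc

theorem integral_vdiv_halfBall (hd : d ≠ 0) {n : Euc d} (hn : n ≠ 0) {φ : Euc d → Euc d}
    (hφ : ContDiff ℝ 1 φ) (hφc : HasCompactSupport φ) :
    ∫ v in {v | ‖v‖ < ‖n‖ ∧ 1 ≤ bisector n v}, vdiv φ v
      = capFlux n φ - planeFlux n (discCone n ‖n‖) φ := by
  have hn0 : 0 < ‖n‖ := norm_pos_iff.2 hn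
  have hb : volume {v : Euc d | ‖v‖ < ‖n‖} ≠ ⊤ :=
    ((measure_mono fun v hv => mem_ball_zero_iff.2 hv).trans_lt
      (measure_ball_lt_top (x := (0 : Euc d)) (r := ‖n‖))).ne
  have h1 := gauss_green_ball hd hn0 hφ hφc
  have h2 := gauss_green_half hd hn le_rfl hφ hφc
  have hm : MeasurableSet {v | bisector n v < 1} :=
    (isOpen_lt (by fun_prop) (by fun_prop)).measurableSet
  have hm' : MeasurableSet {v : Euc d | ‖v‖ / ‖n‖ < bisector n v} :=
    (isOpen_lt (by fun_prop) (by fun_prop)).measurableSet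
  have h3 := integral_inter_add_sdiff hm (integrable_vdiv hφ hφc).integrableOn
    (s := {v : Euc d | ‖v‖ < ‖n‖}) (μ := volume)
  have h4 := integral_inter_add_sdiff hm' (integrableOn_flux
    (ν := fun v => (‖n‖ * ‖v‖)⁻¹ • v) (by fun_prop) (norm_radial_le hn0)
    (π := fun v => (‖n‖ / ‖v‖) • v) (by fun_prop) hb hφ.continuous hφc)
  have e1 : {v : Euc d | ‖v‖ < ‖n‖} ∩ {v | bisector n v < 1}
      = {v | ‖v‖ < ‖n‖ ∧ bisector n v < 1} := rfl
  have e2 : {v : Euc d | ‖v‖ < ‖n‖} \ {v | bisector n v < 1}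
      = {v | ‖v‖ < ‖n‖ ∧ 1 ≤ bisector n v} := by ext; simp
  have e3 : {v : Euc d | ‖v‖ < ‖n‖} ∩ {v | ‖v‖ / ‖n‖ < bisector n v}
      = {v | ‖v‖ < ‖n‖ ∧ ‖v‖ / ‖n‖ < bisector n v} := rfl
  have e4 : {v : Euc d | ‖v‖ < ‖n‖} \ {v | ‖v‖ / ‖n‖ < bisector n v}
      = {v | ‖v‖ < ‖n‖ ∧ bisector n v ≤ ‖v‖ / ‖n‖} := by ext; simp
  rw [e1, e2] at h3
  rw [e3, e4] at h4
  rw [← h4] at h1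
  unfold capFlux planeFlux discCone
  linarith

theorem integral_vdiv_half (hd : d ≠ 0) {n : Euc d} (hn : n ≠ 0) {M : ℝ} (hM : ‖n‖ ≤ M)
    {φ : Euc d → Euc d} (hφ : IsTestField (ball 0 M) φ) :
    ∫ v in {v | bisector n v < 1}, vdiv φ v = planeFlux n (discCone n M) φ := by
  have hM0 : 0 < M := (norm_pos_iff.2 hn).trans_le hM
  have h := gauss_green_half hd hn hM hφ.1 hφ.2
  have hz : ∀ v : Euc d, ¬ ‖v‖ < M → φ v = 0 := fun v hv =>
    hφ.eq_zero fun h => hv (mem_ball_zero_iff.1 h)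
  have h0 : ∀ v : Euc d, ⟪(M * ‖v‖)⁻¹ • v, φ ((M / ‖v‖) • v)⟫ = 0 := by
    intro v
    rcases eq_or_ne v 0 with rfl | hv
    · simp
    · rw [hz, inner_zero_right]
      rw [norm_smul, norm_div, norm_norm, div_mul_cancel₀ _ (norm_ne_zero_iff.2 hv),
        Real.norm_eq_abs, abs_of_pos hM0]
      exact lt_irrefl M
  simp only [h0, integral_zero, mul_zero, add_zero] at h
  rw [planeFlux, discCone, ← h]
  refine setIntegral_eq_of_subset_of_forall_sdiff_eq_zero
    (isOpen_lt (by fun_prop) (by fun_prop)).measurableSet (fun v hv => hv.2) fun v hv => ?_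
  have hv' : v ∉ tsupport φ := fun h' =>
    hv.2 ⟨mem_ball_zero_iff.1 (hφ.tsupport_subset h'), hv.1⟩
  have : fderiv ℝ φ v = 0 :=
    image_eq_zero_of_notMem_tsupport fun h' => hv' (tsupport_fderiv_subset ℝ h')
  simp [vdiv, this]

theorem setIntegral_vdiv_translate (q : Euc d) (S : Set (Euc d)) (φ : Euc d → Euc d) :
    ∫ x in {x | x - q ∈ S}, vdiv φ x = ∫ v in S, vdiv (fun v => φ (q + v)) v := by
  have h : ∀ v, vdiv (fun v => φ (q + v)) v = vdiv φ (q + v) := fun v => by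
    simp only [vdiv, fderiv_comp_add_left]
  simp only [h]
  rw [← (measurePreserving_add_left volume q).setIntegral_preimage_emb
    (measurableEmbedding_addLeft q)]
  congr 2
  ext v
  simp

theorem dist_sq_sub_dist_sq {p q : Euc d} (h : p ≠ q) (x : Euc d) :
    dist x p ^ 2 - dist x q ^ 2 = ‖p - q‖ ^ 2 * (1 - bisector (p - q) (x - q)) := by
  have hn : ‖p - q‖ ≠ 0 := norm_ne_zero_iff.2 (sub_ne_zero.2 h)
  rw [dist_eq_norm, dist_eq_norm, ← sub_sub_sub_cancel_right x p q, norm_sub_sq_real,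
    real_inner_comm, bisector]
  field_simp
  ring

theorem dist_lt_iff_bisector {p q : Euc d} (h : p ≠ q) (x : Euc d) :
    dist x q < dist x p ↔ bisector (p - q) (x - q) < 1 := by
  have hn : 0 < ‖p - q‖ := norm_pos_iff.2 (sub_ne_zero.2 h)
  rw [← sq_lt_sq₀ dist_nonneg dist_nonneg, ← sub_pos, dist_sq_sub_dist_sq h,
    mul_pos_iff_of_pos_left (by positivity), sub_pos]

theorem dist_lt_iff_bisector' {p q : Euc d} (h : p ≠ q) (x : Euc d) :
    dist x p < dist x q ↔ 1 < bisector (p - q) (x - q) := by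
  have hn : 0 < ‖p - q‖ := norm_pos_iff.2 (sub_ne_zero.2 h)
  rw [← sq_lt_sq₀ dist_nonneg dist_nonneg, ← sub_neg, dist_sq_sub_dist_sq h,
    ← neg_pos, ← mul_neg, mul_pos_iff_of_pos_left (by positivity), neg_sub, sub_pos]

theorem IsTestField.translate {U V : Set (Euc d)} {φ : Euc d → Euc d} (hφ : IsTestField U φ)
    (q : Euc d) (hUV : ∀ v, q + v ∈ U → v ∈ V) : IsTestField V fun v => φ (q + v) where
  contDiff := by have := hφ.contDiff; fun_prop
  hasCompactSupport := hφ.hasCompactSupport.comp_homeomorph (Homeomorph.addLeft q)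
  tsupport_subset v hv := hUV v (hφ.tsupport_subset
    (tsupport_comp_subset_preimage φ (f := fun v => q + v) (by fun_prop) hv))
  norm_le v := hφ.norm_le _

/-- The half of the lens `ball p R ∩ ball q R`, where `R = dist p q`, nearer to `p`. -/
def halfLens (p q : Euc d) : Set (Euc d) :=
  {x | dist x p ≤ dist x q} ∩ ball q (dist p q)

theorem halfLens_eq {p q : Euc d} (h : p ≠ q) :
    halfLens p q = {x | x - q ∈ {v | ‖v‖ < ‖p - q‖ ∧ 1 ≤ bisector (p - q) v}} := by
  ext x
  simp only [halfLens, mem_inter_iff, mem_ball, mem_ofPred_eq]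
  rw [← not_lt, dist_lt_iff_bisector h, not_lt, and_comm, dist_eq_norm, dist_eq_norm]

theorem integral_vdiv_halfLens (hd : d ≠ 0) {p q : Euc d} (h : p ≠ q) {φ : Euc d → Euc d}
    {U : Set (Euc d)} (hφ : IsTestField U φ) :
    ∫ x in halfLens p q, vdiv φ x = capFlux (p - q) (fun v => φ (q + v))
      - planeFlux (p - q) (discCone (p - q) ‖p - q‖) (fun v => φ (q + v)) := by
  have hφ' := (hφ.mono (subset_univ U)).translate q (V := univ) fun _ _ => mem_univ _
  rw [halfLens_eq h, setIntegral_vdiv_translate,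
    integral_vdiv_halfBall hd (sub_ne_zero.2 h) hφ'.1 hφ'.2]

theorem integral_vdiv_halfSpace (hd : d ≠ 0) {p q : Euc d} (h : p ≠ q) {M : ℝ}
    (hM : ‖p - q‖ ≤ M) {φ : Euc d → Euc d} (hφ : IsTestField (ball q M) φ) :
    ∫ x in {x | dist x q < dist x p}, vdiv φ x
      = planeFlux (p - q) (discCone (p - q) M) (fun v => φ (q + v)) := by
  rw [← integral_vdiv_half hd (sub_ne_zero.2 h) hM (hφ.translate q (by simp)),
    ← setIntegral_vdiv_translate]
  simp only [dist_lt_iff_bisector h, mem_ofPred_eq]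

theorem planeFlux_discCone_swap {p q : Euc d} (h : p ≠ q) {M : ℝ} (hM : 0 ≤ M)
    (φ : Euc d → Euc d) :
    planeFlux (q - p) (discCone (q - p) M) (fun v => φ (p + v))
      = -planeFlux (p - q) (discCone (p - q) M) (fun v => φ (q + v)) := by
  obtain ⟨n, hn⟩ : ∃ n, n = p - q := ⟨_, rfl⟩
  rw [← hn]
  have hn0 : ‖n‖ ≠ 0 := norm_ne_zero_iff.2 (hn ▸ sub_ne_zero.2 h)
  have hqp : q - p = -n := by simp [hn]
  have hp : p = q + n := by simp [hn]
  rw [hqp, hp]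
  let s := (ℝ ∙ n)ᗮ.reflection
  have hs : ∀ v, s v = v - bisector n v • n := by
    intro v
    simp only [s]
    rw [Submodule.reflection_orthogonal_apply, Submodule.reflection_singleton_apply, bisector]
    rw [neg_sub, ← Nat.cast_smul_eq_nsmul ℝ, smul_smul]
    congr 2
    simp only [RCLike.ofReal_real_eq_id, id]
    push_cast
    ring
  have hbs : ∀ v, bisector (-n) (s v) = bisector n v := by
    intro v
    simp only [hs, bisector, inner_neg_left, inner_sub_right, inner_smul_right,
      real_inner_self_eq_norm_sq, norm_neg]
    field_simp
    ring
  have hpre : s ⁻¹' discCone (-n) M = discCone n M := by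
    ext v
    simp only [discCone, mem_preimage, mem_ofPred_eq, hbs, LinearIsometryEquiv.norm_map]
  rw [planeFlux, planeFlux, ← s.measurePreserving.setIntegral_preimage_emb
    s.toHomeomorph.measurableEmbedding, hpre, ← mul_neg, ← integral_neg]
  congr 1
  refine setIntegral_congr_fun (measurableSet_discCone _ _) fun v hv => ?_
  have hb : bisector n v ≠ 0 := ((div_nonneg (norm_nonneg v) hM).trans_lt hv.1).ne'
  simp only [hbs, norm_neg]
  rw [smul_neg, inner_neg_left, hs, smul_sub, smul_smul, inv_mul_cancel₀ hb, one_smul]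
  congr 3
  abel

theorem halfSpace_ae_eq {p q : Euc d} (h : p ≠ q) :
    ({x | dist x p ≤ dist x q} : Set (Euc d)) =ᵐ[volume] {x | dist x p < dist x q} := by
  have h0 : volume {x : Euc d | dist x p = dist x q} = 0 := by
    have := Measure.addHaar_affineSubspace (volume : Measure (Euc d))
      (AffineSubspace.perpBisector p q) (by rwa [Ne, AffineSubspace.perpBisector_eq_top])
    refine measure_mono_null (fun x hx => ?_) this
    exact AffineSubspace.mem_perpBisector_iff_dist_eq.2 hx
  rw [measure_eq_zero_iff_ae_notMem] at h0
  filter_upwards [h0] with x hx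
  exact propext ⟨fun h => lt_of_le_of_ne h hx, fun h => le_of_lt h⟩

theorem measurableSet_halfLens (p q : Euc d) : MeasurableSet (halfLens p q) :=
  (measurableSet_le (by fun_prop) (by fun_prop)).inter measurableSet_ball

theorem aedisjoint_halfLens {p q : Euc d} (h : p ≠ q) :
    AEDisjoint volume (halfLens p q) (halfLens q p) := by
  have h1 : halfLens p q =ᵐ[volume]
      ({x | dist x p < dist x q} ∩ ball q (dist p q) : Set (Euc d)) :=
    (halfSpace_ae_eq h).inter (ae_eq_refl _)
  have h2 : Disjoint ({x | dist x p < dist x q} ∩ ball q (dist p q) : Set (Euc d))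
      (halfLens q p) :=
    Set.disjoint_left.2 fun x hx hx' => (not_lt.2 hx'.1 : ¬ dist x p < dist x q) hx.1
  exact h2.aedisjoint.congr h1 (ae_eq_refl _)

theorem inter_ball_eq_union_halfLens (p q : Euc d) :
    ball p (dist p q) ∩ ball q (dist p q) = halfLens p q ∪ halfLens q p := by
  ext x
  simp only [halfLens, dist_comm q p, mem_inter_iff, mem_union, mem_ball, mem_ofPred_eq]
  constructor
  · rintro ⟨h1, h2⟩
    rcases le_total (dist x p) (dist x q) with h | h
    · exact .inl ⟨h, h2⟩
    · exact .inr ⟨h, h1⟩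
  · rintro (⟨h1, h2⟩ | ⟨h1, h2⟩)
    · exact ⟨h1.trans_lt h2, h2⟩
    · exact ⟨h2, h1.trans_lt h2⟩

end Lens

section Perimeter

variable {d : ℕ}

/-- The area of the part of the bisector of `0` and `n` spanned by the cone over `S`. -/
def planeArea (n : Euc d) (S : Set (Euc d)) : ℝ := d * (2 / ‖n‖ * volume.real S)

/-- The cone over the part of the sphere of radius `‖n‖` beyond the bisector of `0` and `n`. -/
def capCone (n : Euc d) : Set (Euc d) := {v | ‖v‖ < ‖n‖ ∧ ‖v‖ / ‖n‖ < bisector n v}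

/-- The area of the part of the sphere of radius `‖n‖` beyond the bisector of `0` and `n`. -/
def capArea (n : Euc d) : ℝ := d * (‖n‖⁻¹ * volume.real (capCone n))

theorem measurableSet_capCone (n : Euc d) : MeasurableSet (capCone n) :=
  (measurableSet_lt measurable_norm measurable_const).inter
    (measurableSet_lt (measurable_norm.div_const _) (continuous_bisector n).measurable)

theorem volume_capCone_ne_top (n : Euc d) : volume (capCone n) ≠ ⊤ :=
  ((measure_mono fun _ hv => mem_ball_zero_iff.2 hv.1).trans_lt
    (measure_ball_lt_top (x := (0 : Euc d)) (r := ‖n‖))).ne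

theorem capCone_norm_pos {n v : Euc d} (hv : v ∈ capCone n) : 0 < ‖v‖ := by
  refine norm_pos_iff.2 fun h => ?_
  have := hv.2
  simp [h, bisector] at this

/-- The points `v` for which the ray through `q + v` meets the bisector of `q` and `q + n`
inside `U`. -/
def shadow (n q : Euc d) (U : Set (Euc d)) : Set (Euc d) := {v | q + (bisector n v)⁻¹ • v ∈ U}

theorem measurableSet_shadow (n q : Euc d) {U : Set (Euc d)} (hU : MeasurableSet U) :
    MeasurableSet (shadow n q U) := by
  have := (continuous_bisector n).measurable
  have h : Measurable fun v => q + (bisector n v)⁻¹ • v := by fun_prop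
  exact h hU

theorem norm_bisector_grad (n : Euc d) : ‖(2 / ‖n‖ ^ 2) • n‖ = 2 / ‖n‖ := by
  rw [norm_smul, norm_div, norm_pow, norm_norm, Real.norm_ofNat]
  rcases eq_or_ne ‖n‖ 0 with h | h
  · simp [h]
  · field_simp

theorem abs_planeFlux_le (n q : Euc d) {S : Set (Euc d)} (hS : volume S ≠ ⊤)
    (hSm : MeasurableSet S) {U : Set (Euc d)} {φ : Euc d → Euc d} (hφ : IsTestField U φ) :
    |planeFlux n S fun v => φ (q + v)| ≤ planeArea n (S ∩ shadow n q U) := by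
  rw [planeFlux, planeArea, abs_mul, Nat.abs_cast]
  refine mul_le_mul_of_nonneg_left ?_ (Nat.cast_nonneg d)
  exact abs_flux_le (ν := fun _ => (2 / ‖n‖ ^ 2) • n) (fun _ => (norm_bisector_grad n).le)
    (π := fun v => q + (bisector n v)⁻¹ • v) hS hSm hφ fun v _ hv => hv

theorem abs_capFlux_le {n : Euc d} (hn : n ≠ 0) (q : Euc d) {U : Set (Euc d)}
    {φ : Euc d → Euc d} (hφ : IsTestField U φ) :
    |capFlux n fun v => φ (q + v)| ≤ capArea n := by
  rw [capFlux, capArea, abs_mul, Nat.abs_cast]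
  refine mul_le_mul_of_nonneg_left ?_ (Nat.cast_nonneg d)
  have h := abs_flux_le (ν := fun v => (‖n‖ * ‖v‖)⁻¹ • v) (norm_radial_le (norm_pos_iff.2 hn))
    (π := fun v => q + (‖n‖ / ‖v‖) • v) (T := univ) (volume_capCone_ne_top n)
    (measurableSet_capCone n) hφ (by simp)
  rwa [inter_univ] at h

theorem tendsto_planeFlux {n : Euc d} (hn : n ≠ 0) (q : Euc d) {S : Set (Euc d)}
    (hS : volume S ≠ ⊤) (hSm : MeasurableSet S) {U W : Set (Euc d)} (hU : MeasurableSet U)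
    (hWU : W ⊆ U) {φ : ℕ → Euc d → Euc d} (hφ : ∀ k, IsTestField W (φ k)) {N : Euc d → Euc d}
    (hlim : ∀ x ∈ W, Tendsto (fun k => φ k x) atTop (𝓝 (N x))) (c : ℝ)
    (h : ∀ᵐ v, v ∈ S → q + (bisector n v)⁻¹ • v ∈ U → q + (bisector n v)⁻¹ • v ∈ W ∧
      N (q + (bisector n v)⁻¹ • v) = (c * ‖n‖⁻¹) • n) :
    Tendsto (fun k => planeFlux n S fun v => φ k (q + v)) atTop
      (𝓝 (c * planeArea n (S ∩ shadow n q U))) := by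
  have hn0 := norm_ne_zero_iff.2 hn
  have hb := (continuous_bisector n).measurable
  have h3 := (tendsto_flux (ν := fun _ => (2 / ‖n‖ ^ 2) • n) measurable_const (fun _ => le_rfl)
    (π := fun v => q + (bisector n v)⁻¹ • v) (by fun_prop) hS hSm (measurableSet_shadow n q hU)
    hφ hlim (w := c * (2 / ‖n‖)) ?_ ?_).const_mul (d : ℝ)
  · convert! h3 using 2
    rw [planeArea]
    ring
  · filter_upwards [h] with v hv hvS hvT
    refine ⟨(hv hvS hvT).1, ?_⟩
    rw [(hv hvS hvT).2, inner_smul_left, inner_smul_right, real_inner_self_eq_norm_sq]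
    simp only [conj_trivial]
    field_simp
  · exact .of_forall fun v _ hv hW => hv (hWU hW)

theorem tendsto_capFlux {n : Euc d} (hn : n ≠ 0) (q : Euc d) {W : Set (Euc d)}
    {φ : ℕ → Euc d → Euc d} (hφ : ∀ k, IsTestField W (φ k)) {N : Euc d → Euc d}
    (hlim : ∀ x ∈ W, Tendsto (fun k => φ k x) atTop (𝓝 (N x))) (c : ℝ)
    (h : ∀ v ∈ capCone n, q + (‖n‖ / ‖v‖) • v ∈ W ∧
      N (q + (‖n‖ / ‖v‖) • v) = (c * ‖v‖⁻¹) • v) :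
    Tendsto (fun k => capFlux n fun v => φ k (q + v)) atTop (𝓝 (c * capArea n)) := by
  have hn0 := norm_pos_iff.2 hn
  have h3 := (tendsto_flux (ν := fun v => (‖n‖ * ‖v‖)⁻¹ • v) (by fun_prop) (norm_radial_le hn0)
    (π := fun v => q + (‖n‖ / ‖v‖) • v) (by fun_prop) (volume_capCone_ne_top n)
    (measurableSet_capCone n) .univ hφ hlim (w := c * ‖n‖⁻¹) ?_ ?_).const_mul (d : ℝ)
  · convert! h3 using 2
    rw [capArea, inter_univ]
    ring
  · refine .of_forall fun v hv _ => ⟨(h v hv).1, ?_⟩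
    have hv0 := (capCone_norm_pos hv).ne'
    rw [(h v hv).2, inner_smul_left, inner_smul_right, real_inner_self_eq_norm_sq]
    simp only [conj_trivial]
    field_simp
  · exact .of_forall fun v _ hv => absurd (mem_univ v) hv

theorem perim_halfSpace (hd : d ≠ 0) {p q : Euc d} (h : p ≠ q) {U : Set (Euc d)} (hU : IsOpen U)
    {M : ℝ} (hM : ‖p - q‖ ≤ M) (hUM : U ⊆ ball q M) :
    perim {x | dist x q < dist x p} U
      = ENNReal.ofReal (planeArea (p - q) (discCone (p - q) M ∩ shadow (p - q) q U)) := by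
  have hn : p - q ≠ 0 := sub_ne_zero.2 h
  have hM0 : 0 < M := (norm_pos_iff.2 hn).trans_le hM
  have hS := volume_discCone_ne_top (p - q) hM0
  have hSm := measurableSet_discCone (p - q) M
  obtain ⟨φ, hφ, hlim⟩ := exists_seq_isTestField hU (N := fun _ => ‖p - q‖⁻¹ • (p - q))
    contDiffOn_const fun _ _ => by
      rw [norm_smul, norm_inv, norm_norm, inv_mul_cancel₀ (norm_ne_zero_iff.2 hn)]
  refine perim_eq_ofReal hU (fun ψ hψ => ?_) hφ ?_
  · rw [integral_vdiv_halfSpace hd h hM (hψ.mono hUM)]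
    exact (le_abs_self _).trans (abs_planeFlux_le _ _ hS hSm hψ)
  · have h1 := tendsto_planeFlux hn q hS hSm hU.measurableSet subset_rfl hφ hlim 1
      (.of_forall fun v _ hv => ⟨hv, by rw [one_mul]⟩)
    rw [one_mul] at h1
    exact h1.congr fun k => (integral_vdiv_halfSpace hd h hM ((hφ k).mono hUM)).symm

theorem contDiffOn_radial (q : Euc d) :
    ContDiffOn ℝ 1 (fun x : Euc d => ‖x - q‖⁻¹ • (x - q)) {q}ᶜ := by
  refine fun x hx => ContDiffAt.contDiffWithinAt ?_
  have hx : x - q ≠ 0 := sub_ne_zero.2 hx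
  have h1 : ContDiffAt ℝ 1 (fun x : Euc d => x - q) x := by fun_prop
  exact ((h1.norm ℝ hx).inv (norm_ne_zero_iff.2 hx)).smul h1

theorem norm_normalize_le (v : Euc d) : ‖‖v‖⁻¹ • v‖ ≤ 1 := by
  rw [norm_smul, norm_inv, norm_norm, inv_mul_eq_div]
  exact div_self_le_one _

theorem norm_cap_point {n v : Euc d} (hv : v ∈ capCone n) : ‖(‖n‖ / ‖v‖) • v‖ = ‖n‖ := by
  rw [norm_smul, norm_div, norm_norm, norm_norm, div_mul_cancel₀ _ (capCone_norm_pos hv).ne']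

theorem dist_cap_point {p q v : Euc d} (h : p ≠ q) (hv : v ∈ capCone (p - q)) :
    dist (q + (‖p - q‖ / ‖v‖) • v) p < dist (q + (‖p - q‖ / ‖v‖) • v) q := by
  have hn : 0 < ‖p - q‖ := norm_pos_iff.2 (sub_ne_zero.2 h)
  have hv0 := capCone_norm_pos hv
  rw [dist_lt_iff_bisector' h, add_sub_cancel_left, bisector_smul, div_mul_eq_mul_div,
    one_lt_div hv0, ← div_lt_iff₀' hn]
  exact hv.2

theorem normalize_cap_point {n v : Euc d} (hn : n ≠ 0) (hv : v ∈ capCone n) :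
    ‖(‖n‖ / ‖v‖) • v‖⁻¹ • (‖n‖ / ‖v‖) • v = ‖v‖⁻¹ • v := by
  have hn0 := norm_ne_zero_iff.2 hn
  have hv0 := (capCone_norm_pos hv).ne'
  rw [norm_cap_point hv, smul_smul]
  congr 1
  field_simp

theorem contDiffOn_ite {W V : Set (Euc d)} (hW : IsOpen W) (hV : IsOpen V) {N N' : Euc d → Euc d}
    {P : Euc d → Prop} [DecidablePred P] (hWP : ∀ x ∈ W, P x) (hVP : ∀ x ∈ V, ¬ P x)
    (hN : ContDiffOn ℝ 1 N W) (hN' : ContDiffOn ℝ 1 N' V) :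
    ContDiffOn ℝ 1 (fun x => if P x then N x else N' x) (W ∪ V) :=
  (hN.congr fun x hx => if_pos (hWP x hx)).union_of_isOpen
    (hN'.congr fun x hx => if_neg (hVP x hx)) hW hV

theorem integral_vdiv_lens (hd : d ≠ 0) {p q : Euc d} (h : p ≠ q) {φ : Euc d → Euc d}
    {U : Set (Euc d)} (hφ : IsTestField U φ) :
    ∫ x in halfLens p q ∪ halfLens q p, vdiv φ x
      = capFlux (p - q) (fun v => φ (q + v)) + capFlux (q - p) (fun v => φ (p + v)) := by
  rw [setIntegral_union₀ (aedisjoint_halfLens h) (measurableSet_halfLens q p).nullMeasurableSet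
    (integrable_vdiv hφ.1 hφ.2).integrableOn (integrable_vdiv hφ.1 hφ.2).integrableOn,
    integral_vdiv_halfLens hd h hφ, integral_vdiv_halfLens hd h.symm hφ, norm_sub_rev q p,
    planeFlux_discCone_swap h (norm_nonneg _)]
  ring

theorem perim_lens (hd : d ≠ 0) {p q : Euc d} (h : p ≠ q) {U : Set (Euc d)} (hU : IsOpen U)
    (hpU : closedBall p (dist p q) ⊆ U) (hqU : closedBall q (dist p q) ⊆ U) :
    perim (halfLens p q ∪ halfLens q p) U
      = ENNReal.ofReal (capArea (p - q) + capArea (q - p)) := by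
  classical
  have hn : p - q ≠ 0 := sub_ne_zero.2 h
  have hn' : q - p ≠ 0 := sub_ne_zero.2 h.symm
  have hW : IsOpen (U ∩ {x | dist x p < dist x q}) :=
    hU.inter (isOpen_lt (by fun_prop) (by fun_prop))
  have hV : IsOpen (U ∩ {x | dist x q < dist x p}) :=
    hU.inter (isOpen_lt (by fun_prop) (by fun_prop))
  obtain ⟨φ, hφ, hlim⟩ := exists_seq_isTestField (hW.union hV)
    (contDiffOn_ite (P := fun x => dist x p < dist x q) hW hV (fun x hx => hx.2)
      (fun x hx => not_lt.2 (le_of_lt hx.2))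
      ((contDiffOn_radial q).mono fun x hx hxq => by
        have := hx.2
        rw [mem_singleton_iff.1 hxq] at this
        simp [dist_nonneg.not_gt] at this)
      ((contDiffOn_radial p).mono fun x hx hxq => by
        have := hx.2
        rw [mem_singleton_iff.1 hxq] at this
        simp [dist_nonneg.not_gt] at this))
    (fun x _ => by split_ifs <;> exact norm_normalize_le _)
  refine perim_eq_ofReal hU (fun ψ hψ => ?_)
    (fun k => (hφ k).mono (union_subset inter_subset_left inter_subset_left)) ?_
  · rw [integral_vdiv_lens hd h hψ]
    exact add_le_add ((le_abs_self _).trans (abs_capFlux_le hn q hψ))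
      ((le_abs_self _).trans (abs_capFlux_le hn' p hψ))
  · have h1 := tendsto_capFlux hn q hφ hlim 1 fun v hv => by
      have h2 := dist_cap_point h hv
      refine ⟨.inl ⟨hqU ?_, h2⟩, ?_⟩
      · rw [mem_closedBall, dist_eq_norm, add_sub_cancel_left, norm_cap_point hv, dist_eq_norm]
      · rw [if_pos h2, add_sub_cancel_left, normalize_cap_point hn hv, one_mul]
    have h2 := tendsto_capFlux hn' p hφ hlim 1 fun v hv => by
      have h2 := dist_cap_point h.symm hv
      refine ⟨.inr ⟨hpU ?_, h2⟩, ?_⟩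
      · rw [mem_closedBall, dist_eq_norm, add_sub_cancel_left, norm_cap_point hv, dist_eq_norm']
      · rw [if_neg (not_lt.2 h2.le), add_sub_cancel_left, normalize_cap_point hn' hv, one_mul]
    have h3 := h1.add h2
    rw [one_mul, one_mul] at h3
    exact h3.congr fun k => (integral_vdiv_lens hd h (hφ k)).symm

theorem integral_vdiv_sdiff_halfLens (hd : d ≠ 0) {p q : Euc d} (h : p ≠ q) {M : ℝ}
    (hM : ‖p - q‖ ≤ M) {φ : Euc d → Euc d} (hφ : IsTestField (ball q M) φ) :
    ∫ x in {x | dist x p ≤ dist x q} \ halfLens p q, vdiv φ x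
      = -(capFlux (p - q) (fun v => φ (q + v)) + planeFlux (p - q)
          (discCone (p - q) M \ discCone (p - q) ‖p - q‖) fun v => φ (q + v)) := by
  have hn : p - q ≠ 0 := sub_ne_zero.2 h
  have hn0 := norm_pos_iff.2 hn
  have hint := integrable_vdiv hφ.1 hφ.2
  have hm : MeasurableSet {x : Euc d | dist x q < dist x p} :=
    measurableSet_lt (by fun_prop) (by fun_prop)
  have h1 := integral_add_compl hm hint
  rw [integral_vdiv_eq_zero hφ.1 hφ.2, integral_vdiv_halfSpace hd h hM hφ] at h1
  have hc : {x : Euc d | dist x q < dist x p}ᶜ = {x | dist x p ≤ dist x q} := by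
    ext; simp
  rw [hc] at h1
  have hφ' := (hφ.mono (subset_univ _)).translate q (V := univ) fun _ _ => mem_univ _
  have h2 : planeFlux (p - q) (discCone (p - q) M \ discCone (p - q) ‖p - q‖)
      (fun v => φ (q + v)) = planeFlux (p - q) (discCone (p - q) M) (fun v => φ (q + v))
        - planeFlux (p - q) (discCone (p - q) ‖p - q‖) (fun v => φ (q + v)) := by
    rw [planeFlux, planeFlux, planeFlux, setIntegral_sdiff (measurableSet_discCone _ _)
      (integrableOn_planeFlux _ (volume_discCone_ne_top _ (hn0.trans_le hM)) hφ'.1 hφ'.2)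
      (discCone_subset _ hn0 hM)]
    ring
  rw [setIntegral_sdiff (measurableSet_halfLens p q) hint.integrableOn inter_subset_left,
    integral_vdiv_halfLens hd h hφ, h2]
  linarith

theorem norm_plane_point {n v : Euc d} (hn : n ≠ 0) {M : ℝ} (hM : 0 < M)
    (hv : v ∈ discCone n M) (hv' : v ∉ discCone n ‖n‖) (hne : ‖v‖ / ‖n‖ ≠ bisector n v) :
    ‖n‖ < ‖(bisector n v)⁻¹ • v‖ := by
  have hn0 := norm_pos_iff.2 hn
  have hb : 0 < bisector n v := (div_nonneg (norm_nonneg v) hM.le).trans_lt hv.1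
  have h1 : bisector n v < ‖v‖ / ‖n‖ := by
    rcases lt_or_gt_of_ne hne with h | h
    · exact absurd ⟨h, hv.2⟩ hv'
    · exact h
  rw [norm_smul, norm_inv, Real.norm_eq_abs, abs_of_pos hb, inv_mul_eq_div, lt_div_iff₀ hb]
  rwa [lt_div_iff₀' hn0] at h1

theorem perim_sdiff_halfLens (hd : d ≠ 0) {p q : Euc d} (h : p ≠ q) {U : Set (Euc d)}
    (hU : IsOpen U) (hqU : closedBall q (dist p q) ⊆ U) {M : ℝ} (hUM : U ⊆ ball q M) :
    perim ({x | dist x p ≤ dist x q} \ halfLens p q) U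
      = ENNReal.ofReal (capArea (p - q) + (planeArea (p - q)
          ((discCone (p - q) M \ discCone (p - q) ‖p - q‖) ∩ shadow (p - q) q U))) := by
  classical
  have hn : p - q ≠ 0 := sub_ne_zero.2 h
  have hn0 := norm_pos_iff.2 hn
  have hM : ‖p - q‖ ≤ M := by
    have : p ∈ ball q M := hUM (hqU (mem_closedBall.2 le_rfl))
    rw [← dist_eq_norm]
    exact (mem_ball.1 this).le
  have hM0 := hn0.trans_le hM
  have hS : volume (discCone (p - q) M \ discCone (p - q) ‖p - q‖) ≠ ⊤ :=
    measure_ne_top_of_subset sdiff_subset (volume_discCone_ne_top (p - q) hM0)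
  have hSm := (measurableSet_discCone (p - q) M).diff (measurableSet_discCone (p - q) ‖p - q‖)
  have hW : IsOpen (U ∩ {x | dist x p < dist x q ∧ dist x p < dist p q}) :=
    hU.inter (IsOpen.and (isOpen_lt (by fun_prop) (by fun_prop))
      (isOpen_lt (by fun_prop) (by fun_prop)))
  have hV : IsOpen (U ∩ {x | dist p q < dist x p}) :=
    hU.inter (isOpen_lt (by fun_prop) (by fun_prop))
  have hWV : U ∩ {x | dist x p < dist x q ∧ dist x p < dist p q} ∪ U ∩ {x | dist p q < dist x p}
      ⊆ U := union_subset inter_subset_left inter_subset_left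
  obtain ⟨φ, hφ, hlim⟩ := exists_seq_isTestField (hW.union hV)
    (contDiffOn_ite (P := fun x => dist x p < dist p q) hW hV (fun x hx => hx.2.2)
      (fun x hx => not_lt.2 (le_of_lt hx.2))
      (((contDiffOn_radial q).mono fun x hx hxq => by
        have := hx.2.1
        rw [mem_singleton_iff.1 hxq] at this
        simp [dist_nonneg.not_gt] at this).neg)
      (contDiffOn_const (c := -(‖p - q‖⁻¹ • (p - q)))))
    (fun x _ => by split_ifs <;> exact (norm_neg _).trans_le (norm_normalize_le _))
  refine perim_eq_ofReal hU (fun ψ hψ => ?_) (fun k => (hφ k).mono hWV) ?_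
  · rw [integral_vdiv_sdiff_halfLens hd h hM (hψ.mono hUM)]
    exact (neg_le_abs _).trans ((abs_add_le _ _).trans (add_le_add (abs_capFlux_le hn q hψ)
      (abs_planeFlux_le _ _ hS hSm hψ)))
  · have h1 := tendsto_capFlux hn q hφ hlim (-1) fun v hv => by
      have h2 := dist_cap_point h hv
      have h3 : dist (q + (‖p - q‖ / ‖v‖) • v) q = dist p q := by
        rw [dist_eq_norm, add_sub_cancel_left, norm_cap_point hv, dist_eq_norm]
      refine ⟨.inl ⟨hqU h3.le, h2, h2.trans_eq h3⟩, ?_⟩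
      rw [if_pos (h2.trans_eq h3), add_sub_cancel_left, normalize_cap_point hn hv, neg_one_mul,
        neg_smul]
    have h2 := tendsto_planeFlux hn q hS hSm hU.measurableSet hWV hφ hlim (-1) (by
      filter_upwards [ae_norm_div_ne_bisector hn le_rfl] with v hne hv hvU
      have hb : 0 < bisector (p - q) v := (div_nonneg (norm_nonneg v) hM0.le).trans_lt hv.1.1
      have h3 := norm_plane_point hn hM0 hv.1 hv.2 hne
      have h4 : dist p q < dist (q + (bisector (p - q) v)⁻¹ • v) p := by
        have h5 := dist_sq_sub_dist_sq h (q + (bisector (p - q) v)⁻¹ • v)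
        rw [add_sub_cancel_left, bisector_smul, inv_mul_cancel₀ hb.ne', sub_self, mul_zero,
          sub_eq_zero, sq_eq_sq₀ dist_nonneg dist_nonneg] at h5
        rw [h5, dist_eq_norm, dist_eq_norm, add_sub_cancel_left]
        exact h3
      refine ⟨.inr ⟨hvU, h4⟩, ?_⟩
      rw [if_neg (not_lt.2 h4.le), neg_one_mul, neg_smul])
    have h3 := (h1.add h2).neg
    rw [neg_one_mul, neg_one_mul, neg_add, neg_neg, neg_neg] at h3
    exact h3.congr fun k =>
      (integral_vdiv_sdiff_halfLens hd h hM ((hφ k).mono (hWV.trans hUM))).symm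

end Perimeter

section Excess

variable {d : ℕ}

theorem capArea_sub_planeArea {p q : Euc d} (h : p ≠ q) :
    capArea (p - q) - planeArea (p - q) (discCone (p - q) ‖p - q‖) / 2
      = d / ‖p - q‖ * volume.real (halfLens p q) := by
  have hn0 : 0 < ‖p - q‖ := norm_pos_iff.2 (sub_ne_zero.2 h)
  obtain ⟨n, hn⟩ : ∃ n, n = p - q := ⟨_, rfl⟩
  rw [halfLens_eq h, ← hn]
  rw [← hn] at hn0
  have h1 : discCone n ‖n‖ ⊆ capCone n := fun v hv =>
    ⟨(div_lt_one hn0).1 (hv.1.trans hv.2), hv.1⟩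
  have h2 : capCone n \ discCone n ‖n‖ = {v | ‖v‖ < ‖n‖ ∧ 1 ≤ bisector n v} := by
    ext v
    simp only [capCone, discCone, Set.mem_sdiff, mem_ofPred_eq, not_and, not_lt]
    exact ⟨fun hv => ⟨hv.1.1, hv.2 hv.1.2⟩, fun hv =>
      ⟨⟨hv.1, ((div_lt_one hn0).2 hv.1).trans_le hv.2⟩, fun _ => hv.2⟩⟩
  have h3 : volume.real {x | x - q ∈ {v | ‖v‖ < ‖n‖ ∧ 1 ≤ bisector n v}}
      = volume.real (capCone n) - volume.real (discCone n ‖n‖) := by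
    rw [← measureReal_sdiff h1 (measurableSet_discCone _ _) (volume_capCone_ne_top n), h2]
    simp only [measureReal_def, sub_eq_add_neg]
    exact congrArg _ (measure_preimage_add_right volume (-q) _)
  rw [h3, capArea, planeArea]
  ring

theorem planeArea_sdiff_discCone {p q : Euc d} (h : p ≠ q) {U : Set (Euc d)}
    (hqU : closedBall q (dist p q) ⊆ U) {M : ℝ} (hM : ‖p - q‖ ≤ M) :
    planeArea (p - q) ((discCone (p - q) M \ discCone (p - q) ‖p - q‖) ∩ shadow (p - q) q U)
      = planeArea (p - q) (discCone (p - q) M ∩ shadow (p - q) q U)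
        - planeArea (p - q) (discCone (p - q) ‖p - q‖) := by
  have hn0 : 0 < ‖p - q‖ := norm_pos_iff.2 (sub_ne_zero.2 h)
  have h1 : discCone (p - q) ‖p - q‖ ⊆ discCone (p - q) M ∩ shadow (p - q) q U := by
    refine subset_inter (discCone_subset _ hn0 hM) fun v hv => hqU ?_
    have hb : 0 < bisector (p - q) v := (by positivity : 0 ≤ ‖v‖ / ‖p - q‖).trans_lt hv.1
    rw [mem_closedBall, dist_eq_norm, add_sub_cancel_left, norm_smul, norm_inv, Real.norm_eq_abs,
      abs_of_pos hb, inv_mul_eq_div, div_le_iff₀ hb, dist_eq_norm, ← div_le_iff₀' hn0]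
    exact hv.1.le
  have h2 : volume (discCone (p - q) M ∩ shadow (p - q) q U) ≠ ⊤ :=
    measure_ne_top_of_subset inter_subset_left (volume_discCone_ne_top _ (hn0.trans_le hM))
  rw [← inter_sdiff_right_comm, planeArea, measureReal_sdiff h1 (measurableSet_discCone _ _) h2,
    planeArea, planeArea]
  ring

theorem volume_lens {p q : Euc d} (h : p ≠ q) :
    volume.real (ball p (dist p q) ∩ ball q (dist p q))
      = volume.real (halfLens p q) + volume.real (halfLens q p) := by
  have hfin : ∀ x y : Euc d, volume (halfLens x y) ≠ ⊤ := fun x y =>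
    measure_ne_top_of_subset inter_subset_right measure_ball_lt_top.ne
  rw [inter_ball_eq_union_halfLens, measureReal_def,
    measure_union₀ (measurableSet_halfLens q p).nullMeasurableSet (aedisjoint_halfLens h),
    ENNReal.toReal_add (hfin _ _) (hfin _ _)]
  rfl

theorem partPerim_lens_sub (hd : d ≠ 0) {p q : Euc d} (h : p ≠ q) {L : Fin 3 → Set (Euc d)}
    (h0 : L 0 = ball p (dist p q) ∩ ball q (dist p q))
    (h1 : L 1 = {x | dist x p ≤ dist x q} \ L 0)
    (h2 : L 2 = univ \ ({x | dist x p ≤ dist x q} ∪ L 0)) {r : ℝ}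
    (hr : ‖p‖ + ‖q‖ + dist p q < r) :
    (partPerim L (ball 0 r)).toReal - (partPerim (![(∅ : Set (Euc d)),
        {x | dist x p ≤ dist x q}, {x | dist x q < dist x p}]) (ball 0 r)).toReal
      = d / dist p q * volume.real (L 0) := by
  have hU : IsOpen (ball (0 : Euc d) r) := isOpen_ball
  have hp0 := norm_nonneg p
  have hq0 := norm_nonneg q
  have hpU : closedBall p (dist p q) ⊆ ball 0 r :=
    closedBall_subset_ball' (by rw [dist_zero_right]; linarith)
  have hqU : closedBall q (dist p q) ⊆ ball 0 r :=
    closedBall_subset_ball' (by rw [dist_zero_right]; linarith)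
  have hUp : ball 0 r ⊆ ball p (r + ‖p‖) := ball_subset_ball' (by rw [dist_zero_left])
  have hUq : ball 0 r ⊆ ball q (r + ‖q‖) := ball_subset_ball' (by rw [dist_zero_left])
  have hMp : ‖q - p‖ ≤ r + ‖p‖ := by rw [← dist_eq_norm, dist_comm]; linarith
  have hMq : ‖p - q‖ ≤ r + ‖q‖ := by rw [← dist_eq_norm]; linarith
  rw [inter_ball_eq_union_halfLens] at h0
  have e1 : L 1 = {x | dist x p ≤ dist x q} \ halfLens p q := by
    rw [h1, h0]
    ext x
    simp only [halfLens, Set.mem_sdiff, mem_union, mem_inter_iff, mem_ball, mem_ofPred_eq,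
      dist_comm q p]
    grind
  have e2 : L 2 =ᵐ[volume] ({x | dist x q ≤ dist x p} \ halfLens q p : Set (Euc d)) := by
    have : L 2 = {x | dist x q < dist x p} \ halfLens q p := by
      rw [h2, h0]
      ext x
      simp only [halfLens, Set.mem_sdiff, mem_union, mem_inter_iff, mem_ball, mem_ofPred_eq,
        dist_comm q p, mem_univ]
      grind
    rw [this]
    exact (halfSpace_ae_eq h.symm).symm.diff (ae_eq_refl _)
  have hqU' : closedBall p (dist q p) ⊆ ball 0 r := by rwa [dist_comm]
  have k0 := capArea_sub_planeArea h
  have k1 := capArea_sub_planeArea h.symm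
  have k2 := planeArea_sdiff_discCone h hqU hMq
  have k3 := planeArea_sdiff_discCone h.symm hqU' hMp
  have c0 : 0 ≤ capArea (p - q) := by unfold capArea; positivity
  have c1 : 0 ≤ capArea (q - p) := by unfold capArea; positivity
  have c2 : ∀ (n : Euc d) S, 0 ≤ planeArea n S := fun n S => by unfold planeArea; positivity
  have hV := volume_lens h
  rw [inter_ball_eq_union_halfLens] at hV
  simp only [partPerim, Fin.sum_univ_three, Matrix.cons_val, perim_empty, zero_add]
  rw [h0, e1, perim_congr_ae e2, perim_congr_ae (halfSpace_ae_eq h), perim_lens hd h hU hpU hqU,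
    perim_sdiff_halfLens hd h hU hqU hUq, perim_sdiff_halfLens hd h.symm hU hqU' hUp,
    perim_halfSpace hd h hU hMq hUq, perim_halfSpace hd h.symm hU hMp hUp,
    ENNReal.toReal_div, ENNReal.toReal_div, ← ENNReal.ofReal_add, ← ENNReal.ofReal_add,
    ← ENNReal.ofReal_add, ENNReal.toReal_ofReal, ENNReal.toReal_ofReal, k2, k3, hV,
    dist_eq_norm]
  · rw [norm_sub_rev q p] at k1
    rw [norm_sub_rev q p, mul_add, ← k0, ← k1, ENNReal.toReal_ofNat]
    ring
  all_goals
    first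
    | exact c2 _ _
    | exact add_nonneg c0 c1
    | exact add_nonneg c0 (c2 _ _)
    | exact add_nonneg c1 (c2 _ _)
    | exact add_nonneg (c2 _ _) (c2 _ _)
    | exact add_nonneg (add_nonneg c0 c1) (add_nonneg c0 (c2 _ _))
    | exact add_nonneg (add_nonneg (add_nonneg c0 c1) (add_nonneg c0 (c2 _ _)))
        (add_nonneg c1 (c2 _ _))

end Excess

section Volume

theorem volume_ball_seven {r : ℝ} (hr : 0 ≤ r) :
    volume.real (ball (0 : Euc 7) r) = 16 * Real.pi ^ 3 / 105 * r ^ 7 := by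
  rw [measureReal_def, InnerProductSpace.volume_ball_of_dim_odd (k := 3) (by simp)]
  rw [ENNReal.toReal_mul, ENNReal.toReal_pow, ENNReal.toReal_ofReal hr,
    ENNReal.toReal_ofReal (by positivity)]
  simp [Nat.doubleFactorial]
  ring

theorem integral_sin_pow_eight : ∫ x in (0 : ℝ)..Real.pi / 3, Real.sin x ^ 8
    = 35 * Real.pi / 384 - 279 * Real.sqrt 3 / 2048 := by
  have h3 : Real.sqrt 3 ^ 2 = 3 := Real.sq_sqrt (by norm_num)
  simp only [integral_sin_pow, Real.sin_zero, Real.cos_zero, Real.sin_pi_div_three,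
    Real.cos_pi_div_three]
  norm_num
  have h5 : Real.sqrt 3 ^ 3 = 3 * Real.sqrt 3 := by rw [pow_succ, h3]
  have h6 : Real.sqrt 3 ^ 5 = 9 * Real.sqrt 3 := by
    rw [show 5 = 2 * 2 + 1 from rfl, pow_succ, pow_mul, h3]; norm_num
  have h7 : Real.sqrt 3 ^ 7 = 27 * Real.sqrt 3 := by
    rw [show 7 = 2 * 3 + 1 from rfl, pow_succ, pow_mul, h3]; norm_num
  simp only [div_pow, h5, h6, h7]
  ring

theorem integral_sqrt_sub_sq_pow {R : ℝ} (hR : 0 < R) :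
    ∫ t in R / 2..R, Real.sqrt (R ^ 2 - t ^ 2) ^ 7
      = R ^ 8 * ∫ x in (0 : ℝ)..Real.pi / 3, Real.sin x ^ 8 := by
  have h := intervalIntegral.integral_comp_mul_deriv (a := 0) (b := Real.pi / 3)
    (f := fun x => R * Real.cos x) (f' := fun x => R * -Real.sin x)
    (g := fun t => Real.sqrt (R ^ 2 - t ^ 2) ^ 7)
    (fun x _ => (Real.hasDerivAt_cos x).const_mul R) (by fun_prop) (by fun_prop)
  simp only [Real.cos_zero, mul_one, Real.cos_pi_div_three, Function.comp_apply] at h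
  rw [← div_eq_mul_one_div] at h
  rw [intervalIntegral.integral_symm, ← h, ← intervalIntegral.integral_neg,
    ← intervalIntegral.integral_const_mul]
  refine intervalIntegral.integral_congr fun x hx => ?_
  rw [uIcc_of_le (by positivity)] at hx
  have hs : 0 ≤ Real.sin x := Real.sin_nonneg_of_nonneg_of_le_pi hx.1
    (hx.2.trans (by linarith [Real.pi_pos]))
  have : R ^ 2 - (R * Real.cos x) ^ 2 = (R * Real.sin x) ^ 2 := by
    rw [mul_pow, mul_pow, Real.sin_sq]; ring
  simp only [this, Real.sqrt_sq (mul_nonneg hR.le hs)]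
  ring

theorem volume_cap {R a : ℝ} (ha : 0 ≤ a) (haR : a ≤ R) :
    volume.real {v : Euc 8 | ‖v‖ < R ∧ a ≤ v 0}
      = 16 * Real.pi ^ 3 / 105 * ∫ t in a..R, Real.sqrt (R ^ 2 - t ^ 2) ^ 7 := by
  have hR : 0 ≤ R := ha.trans haR
  have hmp := (volume_preserving_piFinSuccAbove (fun _ : Fin 8 => ℝ) 0).comp
    (PiLp.volume_preserving_ofLp (Fin 8))
  obtain ⟨A, hA⟩ : ∃ A : Set (ℝ × (Fin 7 → ℝ)),
    A = {z | (z.1 ^ 2 + ∑ i, z.2 i ^ 2 < R ^ 2) ∧ a ≤ z.1} := ⟨_, rfl⟩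
  have hAm : MeasurableSet A := by
    rw [hA]
    have h1 : MeasurableSet {z : ℝ × (Fin 7 → ℝ) | z.1 ^ 2 + ∑ i, z.2 i ^ 2 < R ^ 2} :=
      measurableSet_lt (by fun_prop) (by fun_prop)
    have h2 : MeasurableSet {z : ℝ × (Fin 7 → ℝ) | a ≤ z.1} :=
      measurableSet_le (by fun_prop) (by fun_prop)
    exact h1.inter h2
  have hpre : {v : Euc 8 | ‖v‖ < R ∧ a ≤ v 0}
      = (MeasurableEquiv.piFinSuccAbove (fun _ : Fin 8 => ℝ) 0 ∘ WithLp.ofLp) ⁻¹' A := by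
    ext v
    have : ‖v‖ < R ↔ v 0 ^ 2 + ∑ i : Fin 7, v i.succ ^ 2 < R ^ 2 := by
      rw [← Fin.sum_univ_succ (f := fun i => v i ^ 2), ← EuclideanSpace.real_norm_sq_eq,
        sq_lt_sq₀ (norm_nonneg _) hR]
    simp only [mem_ofPred_eq, this, hA]
    rfl
  have hslice : ∀ t, volume (Prod.mk t ⁻¹' A) = (Icc a R).indicator (fun t =>
      ENNReal.ofReal (16 * Real.pi ^ 3 / 105 * Real.sqrt (R ^ 2 - t ^ 2) ^ 7)) t := by
    intro t
    by_cases ht : t ∈ Icc a R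
    · rw [indicator_of_mem ht, ← volume_ball_seven (Real.sqrt_nonneg _), measureReal_def,
        ENNReal.ofReal_toReal measure_ball_lt_top.ne,
        ← (PiLp.volume_preserving_ofLp (Fin 7)).measure_preimage
          (measurable_prodMk_left hAm).nullMeasurableSet]
      congr 1
      ext w
      rw [mem_ball_zero_iff, Real.lt_sqrt (norm_nonneg _), EuclideanSpace.real_norm_sq_eq]
      simp only [hA, mem_preimage, mem_ofPred_eq, ht.1, and_true, lt_sub_iff_add_lt']
    · rw [indicator_of_notMem ht]
      refine measure_mono_null (fun w hw => ht ?_) measure_empty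
      simp only [hA, mem_preimage, mem_ofPred_eq] at hw
      refine ⟨hw.2, abs_le_of_sq_le_sq' ?_ hR |>.2⟩
      have : 0 ≤ ∑ i, w i ^ 2 := Finset.sum_nonneg fun i _ => sq_nonneg _
      linarith
  rw [hpre, measureReal_def, hmp.measure_preimage hAm.nullMeasurableSet, Measure.volume_eq_prod,
    Measure.prod_apply hAm]
  simp only [hslice]
  have hc : Continuous fun t => 16 * Real.pi ^ 3 / 105 * Real.sqrt (R ^ 2 - t ^ 2) ^ 7 := by
    fun_prop
  rw [lintegral_indicator measurableSet_Icc, ← ofReal_integral_eq_lintegral_ofReal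
    hc.continuousOn.integrableOn_Icc (.of_forall fun t => by positivity),
    ENNReal.toReal_ofReal (integral_nonneg fun t => by positivity),
    integral_Icc_eq_integral_Ioc, ← intervalIntegral.integral_of_le haR,
    intervalIntegral.integral_const_mul]

theorem volume_halfLens {p q : Euc 8} (h : p ≠ q) :
    volume.real (halfLens p q) = 16 * Real.pi ^ 3 / 105 * (dist p q ^ 8 *
      (35 * Real.pi / 384 - 279 * Real.sqrt 3 / 2048)) := by
  have hn0 : 0 < ‖p - q‖ := norm_pos_iff.2 (sub_ne_zero.2 h)
  obtain ⟨n, hn⟩ : ∃ n, n = p - q := ⟨_, rfl⟩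
  have hd : dist p q = ‖n‖ := by rw [dist_eq_norm, hn]
  rw [halfLens_eq h, ← hn]
  rw [← hn] at hn0
  let w : Euc 8 := EuclideanSpace.single 0 ‖n‖
  have hw : ‖n‖ = ‖w‖ := by simp [w]
  let s := (ℝ ∙ (n - w))ᗮ.reflection
  have hs : s n = w := Submodule.reflection_sub hw
  have hset : {v | ‖v‖ < ‖n‖ ∧ 1 ≤ bisector n v}
      = s ⁻¹' {v : Euc 8 | ‖v‖ < ‖n‖ ∧ ‖n‖ / 2 ≤ v 0} := by
    ext v
    simp only [mem_preimage, mem_ofPred_eq, LinearIsometryEquiv.norm_map]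
    rw [bisector, ← s.inner_map_map n v, hs, EuclideanSpace.inner_single_left]
    simp only [conj_trivial]
    rw [div_mul_eq_mul_div, one_le_div (by positivity)]
    refine and_congr_right fun _ => ⟨fun h => ?_, fun h => ?_⟩ <;> nlinarith
  have hm : MeasurableSet {v : Euc 8 | ‖v‖ < ‖n‖ ∧ ‖n‖ / 2 ≤ v 0} := by
    have h1 : MeasurableSet {v : Euc 8 | ‖v‖ < ‖n‖} :=
      measurableSet_lt (by fun_prop) (by fun_prop)
    have h2 : MeasurableSet {v : Euc 8 | ‖n‖ / 2 ≤ v 0} :=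
      measurableSet_le (by fun_prop) (by fun_prop)
    exact h1.inter h2
  have ht : volume {x | x - q ∈ {v | ‖v‖ < ‖n‖ ∧ 1 ≤ bisector n v}}
      = volume {v | ‖v‖ < ‖n‖ ∧ 1 ≤ bisector n v} := by
    simp only [sub_eq_add_neg]
    exact measure_preimage_add_right volume (-q) _
  rw [measureReal_def, ht, hset, s.measurePreserving.measure_preimage hm.nullMeasurableSet,
    ← measureReal_def, volume_cap (by positivity) (by linarith), integral_sqrt_sub_sq_pow hn0,
    integral_sin_pow_eight, hd]

end Volume

/-- **Defect of the lens partition of `ℝ⁸`.** The blow-down of a lens partition is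
`(∅, H, ℝ⁸ \ H)` with `H = {x : dist x p ≤ dist x q}`. -/
theorem lens_defect (L : Fin 3 → Set (Euc 8)) (p q : Euc 8) (R : ℝ)
    (hR : 0 < R) (hpq : dist p q = R)
    (h0 : L 0 = ball p R ∩ ball q R)
    (h1 : L 1 = {x | dist x p ≤ dist x q} \ L 0)
    (h2 : L 2 = univ \ ({x | dist x p ≤ dist x q} ∪ L 0)) :
    liminf (fun r : ℝ =>
        ((partPerim L (ball 0 r)).toReal -
          (partPerim (![(∅ : Set (Euc 8)), {x | dist x p ≤ dist x q},
              {x | dist x q < dist x p}]) (ball 0 r)).toReal) /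
          (volume (L 0)).toReal ^ ((7 : ℝ) / 8)) atTop
      = 4 * (4 * Real.pi ^ 3 * ((16 / 9) * Real.pi - (93 / 35) * Real.sqrt 3)) ^ ((1 : ℝ) / 8) := by
  subst hpq
  have h : p ≠ q := dist_pos.1 hR
  have hX : 0 < (16 / 9) * Real.pi - (93 / 35) * Real.sqrt 3 := by
    have : Real.sqrt 3 < 2 := by rw [Real.sqrt_lt' two_pos]; norm_num
    nlinarith [Real.pi_gt_three, Real.sq_sqrt (show (0 : ℝ) ≤ 3 by norm_num)]
  obtain ⟨Y, hY⟩ : ∃ Y, Y = 4 * Real.pi ^ 3 * ((16 / 9) * Real.pi - (93 / 35) * Real.sqrt 3) :=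
    ⟨_, rfl⟩
  have hY0 : 0 < Y := by rw [hY]; positivity
  have hV : volume.real (L 0) = (dist p q / 2) ^ 8 * Y := by
    rw [h0, volume_lens h, volume_halfLens h, volume_halfLens h.symm, dist_comm q p, hY]
    ring
  obtain ⟨V, hVd⟩ : ∃ V, V = (dist p q / 2) ^ 8 * Y := ⟨_, rfl⟩
  have hV0 : 0 < V := by rw [hVd]; positivity
  have hroot : V ^ ((1 : ℝ) / 8) = dist p q / 2 * Y ^ ((1 : ℝ) / 8) := by
    rw [hVd, Real.mul_rpow (by positivity) hY0.le, ← Real.rpow_natCast,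
      ← Real.rpow_mul (by positivity)]
    norm_num
  have hsplit : V = V ^ ((1 : ℝ) / 8) * V ^ ((7 : ℝ) / 8) := by
    rw [← Real.rpow_add hV0]
    norm_num
  have h7 : 0 < V ^ ((7 : ℝ) / 8) := Real.rpow_pos_of_pos hV0 _
  refine (tendsto_const_nhds.congr' ?_).liminf_eq
  filter_upwards [eventually_gt_atTop (‖p‖ + ‖q‖ + dist p q)] with r hr
  rw [partPerim_lens_sub (by norm_num) h h0 h1 h2 hr, ← measureReal_def, hV, ← hVd, ← hY,
    eq_div_iff h7.ne']
  nth_rw 2 [hsplit]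
  rw [hroot]
  field_simp
  norm_num
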